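/- Let f : ℝ → ℝ be infinitely differentiable. Then for every T > 0, sup_{0 ≤ t ≤ T} |f(B(⌊nt⌋/n)) − f(B(0)) − ∑_{j=1}^{⌊nt⌋} ( f'(β_{j,n}) ΔB_{j,n} + (1/24) f'''(β_{j,n}) (ΔB_{j,n})³ )| → 0 in probability as n → ∞. -/

import Mathlib

open MeasureTheory ProbabilityTheory Filter Topology

noncomputable section

/-- `B` is a fractional Brownian motion with Hurst parameter `1/6`: a centered Gaussian
process with continuous sample paths and covariance
`E[B s * B t] = (t^(1/3) + s^(1/3) - |t - s|^(1/3)) / 2` for `s, t ≥ 0`. -/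
def IsFBM16 {Ω : Type*} [MeasureSpace Ω] (B : ℝ → Ω → ℝ) : Prop :=
  (∀ t : ℝ, Measurable (B t)) ∧
  (∀ ω : Ω, Continuous fun t : ℝ => B t ω) ∧
  (∀ (m : ℕ) (t : Fin m → ℝ) (c : Fin m → ℝ), (∀ i, 0 ≤ t i) →
    ∃ v : NNReal,
      Measure.map (fun ω => ∑ i, c i * B (t i) ω) (volume : Measure Ω) = gaussianReal 0 v) ∧
  (∀ s t : ℝ, 0 ≤ s → 0 ≤ t →
    ∫ ω, B s ω * B t ω =
      (t ^ ((1 : ℝ) / 3) + s ^ ((1 : ℝ) / 3) - |t - s| ^ ((1 : ℝ) / 3)) / 2)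

/-- Taylor's theorem with a uniform remainder bound on a symmetric interval. -/
theorem abs_sub_taylor_sum_le {f : ℝ → ℝ} (hf : ContDiff ℝ (⊤ : ℕ∞) f) {R C : ℝ} {m : ℕ}
    (hC : ∀ y, |y| ≤ R → |iteratedDeriv (m + 1) f y| ≤ C) {x c : ℝ} (hx : |x| ≤ R)
    (hc : |c| ≤ R) :
    |f x - ∑ k ∈ Finset.range (m + 1), iteratedDeriv k f c / k.factorial * (x - c) ^ k|
      ≤ C * |x - c| ^ (m + 1) := by
  have hC0 : 0 ≤ C := (abs_nonneg _).trans (hC x hx)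
  rcases eq_or_ne c x with rfl | hne
  · rw [Finset.sum_range_succ']
    simp
  · have hfm : ContDiff ℝ (m + 1 : ℕ) f := hf.of_le (by exact_mod_cast le_top)
    obtain ⟨y, hy, h⟩ := taylor_mean_remainder_lagrange_iteratedDeriv (n := m) hne
      hfm.contDiffOn
    have hsum : taylorWithinEval f m (Set.uIcc c x) c x =
        ∑ k ∈ Finset.range (m + 1), iteratedDeriv k f c / k.factorial * (x - c) ^ k := by
      rw [taylor_within_apply]
      refine Finset.sum_congr rfl fun k hk => ?_
      rw [iteratedDerivWithin_eq_iteratedDeriv (uniqueDiffOn_uIcc hne)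
        ((hf.of_le (by exact_mod_cast le_top) : ContDiff ℝ k f).contDiffAt) Set.left_mem_uIcc]
      simp only [smul_eq_mul]
      ring
    rw [← hsum, h, abs_div, abs_mul, abs_pow]
    have hyR : |y| ≤ R := by
      have hy' := Set.uIoo_subset_uIcc_self hy
      have : Set.uIcc c x ⊆ Set.Icc (-R) R :=
        Set.uIcc_subset_Icc (abs_le.1 hc) (abs_le.1 hx)
      exact abs_le.2 (this hy')
    have h1 : (1 : ℝ) ≤ |(((m + 1).factorial : ℕ) : ℝ)| := by
      rw [abs_of_nonneg (by positivity)]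
      exact_mod_cast Nat.one_le_iff_ne_zero.2 (Nat.factorial_ne_zero _)
    refine (div_le_self (by positivity) h1).trans ?_
    exact mul_le_mul_of_nonneg_right (hC y hyR) (by positivity)

/-- Midpoint expansion of a smooth function up to seventh order. -/
theorem abs_midpoint_expansion_le {f : ℝ → ℝ} (hf : ContDiff ℝ (⊤ : ℕ∞) f) {R C : ℝ}
    (hC : ∀ y, |y| ≤ R → |iteratedDeriv 7 f y| ≤ C) {a b : ℝ} (ha : |a| ≤ R) (hb : |b| ≤ R) :
    |f b - f a - (deriv f ((a + b) / 2) * (b - a)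
        + (1 / 24) * iteratedDeriv 3 f ((a + b) / 2) * (b - a) ^ 3)
        - iteratedDeriv 5 f ((a + b) / 2) / 1920 * (b - a) ^ 5| ≤ C * |b - a| ^ 7 := by
  have hC0 : 0 ≤ C := (abs_nonneg _).trans (hC a ha)
  have hm : |(a + b) / 2| ≤ R := by
    rw [abs_le] at *
    constructor <;> linarith [ha.1, ha.2, hb.1, hb.2]
  have h1 := abs_sub_taylor_sum_le hf hC (x := b) hb hm
  have h2 := abs_sub_taylor_sum_le hf hC (x := a) ha hm
  have e1 : b - (a + b) / 2 = (b - a) / 2 := by ring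
  have e2 : a - (a + b) / 2 = -((b - a) / 2) := by ring
  rw [e1] at h1
  rw [e2] at h2
  simp only [Finset.sum_range_succ, Finset.sum_range_zero, iteratedDeriv_zero, iteratedDeriv_one,
    Nat.factorial] at h1 h2
  rw [abs_neg] at h2
  have h3 := (abs_sub _ _).trans (add_le_add h1 h2)
  have h4 : C * |(b - a) / 2| ^ (6 + 1) + C * |(b - a) / 2| ^ (6 + 1) ≤ C * |b - a| ^ 7 := by
    rw [abs_div, div_pow]
    have : 0 ≤ C * |b - a| ^ 7 := by positivity
    norm_num
    linarith
  refine le_trans (le_of_eq ?_) (h3.trans h4)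
  congr 1
  push_cast
  ring

theorem sum_range_mul_eq_sum_blocks (a : ℕ → ℝ) (L Q : ℕ) :
    ∑ i ∈ Finset.range (Q * L), a i =
      ∑ q ∈ Finset.range Q, ∑ r ∈ Finset.range L, a (q * L + r) := by
  induction Q with
  | zero => simp
  | succ Q ih => rw [Nat.succ_mul, Finset.sum_range_add, ih, Finset.sum_range_succ]

/-- A partial sum is controlled by full block sums and the terms of a final incomplete block. -/
theorem abs_sum_range_le_blocks (a : ℕ → ℝ) (L K : ℕ) :
    |∑ i ∈ Finset.range K, a i| ≤
      ∑ q ∈ Finset.range (K / L), |∑ r ∈ Finset.range L, a (q * L + r)|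
        + ∑ r ∈ Finset.range (K % L), |a (K / L * L + r)| := by
  have hK : K = K / L * L + K % L := by rw [mul_comm]; exact (Nat.div_add_mod K L).symm
  conv_lhs => rw [hK]
  rw [Finset.sum_range_add, sum_range_mul_eq_sum_blocks]
  refine (abs_add_le _ _).trans (add_le_add ?_ ?_) <;> exact Finset.abs_sum_le_sum_abs _ _

/-- The increment of a sequence. -/
def incr (b : ℕ → ℝ) (i : ℕ) : ℝ := b (i + 1) - b i

/-- The displacement of the midpoint of `b (s + r)` and `b (s + r + 1)` from `b s`. -/
def midDev (b : ℕ → ℝ) (s r : ℕ) : ℝ := (b (s + r) + b (s + r + 1)) / 2 - b s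

/-- The sum of fifth powers of increments over the block of length `L` starting at `s`. -/
def blockSum (b : ℕ → ℝ) (L s : ℕ) : ℝ := ∑ r ∈ Finset.range L, incr b (s + r) ^ 5

/-- The first-order Taylor correction to the fifth-power sum over a block. -/
def blockDev (b : ℕ → ℝ) (L s : ℕ) : ℝ :=
  ∑ r ∈ Finset.range L, midDev b s r * incr b (s + r) ^ 5

/-- The second-order Taylor remainder of the fifth-power sum over a block. -/
def blockRem (b : ℕ → ℝ) (L s : ℕ) : ℝ :=
  ∑ r ∈ Finset.range L, midDev b s r ^ 2 * |incr b (s + r)| ^ 5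

/-- A quantity dominating the error of the third-order midpoint expansion along `b`. -/
def expansionError (b : ℕ → ℝ) (L N : ℕ) (τ : ℝ) : ℝ :=
  ∑ i ∈ Finset.range N, |incr b i| ^ 7
    + (∑ q ∈ Finset.range (N / L),
        (|blockSum b L (q * L)| + |blockDev b L (q * L)| + blockRem b L (q * L))
      + (L * τ + τ⁻¹ * ∑ i ∈ Finset.range N, incr b i ^ 10))

theorem expansionError_nonneg (b : ℕ → ℝ) (L N : ℕ) {τ : ℝ} (hτ : 0 ≤ τ) :
    0 ≤ expansionError b L N τ := by
  unfold expansionError blockRem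
  have : ∀ i, 0 ≤ incr b i ^ 10 := fun i => Even.pow_nonneg (by decide) _
  have : 0 ≤ ∑ i ∈ Finset.range N, incr b i ^ 10 := Finset.sum_nonneg fun i _ => this i
  positivity

theorem abs_block_sum_le {g : ℝ → ℝ} (hg : ContDiff ℝ (⊤ : ℕ∞) g) {R C : ℝ}
    (hg0 : ∀ y, |y| ≤ R → |g y| ≤ C) (hg1 : ∀ y, |y| ≤ R → |deriv g y| ≤ C)
    (hg2 : ∀ y, |y| ≤ R → |iteratedDeriv 2 g y| ≤ C) {b : ℕ → ℝ} {s L : ℕ}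
    (hb : ∀ i ≤ s + L, |b i| ≤ R) :
    |∑ r ∈ Finset.range L, g ((b (s + r) + b (s + r + 1)) / 2) * incr b (s + r) ^ 5| ≤
      C * (|blockSum b L s| + |blockDev b L s| + blockRem b L s) := by
  have hbs : |b s| ≤ R := hb s (by omega)
  have hC0 : 0 ≤ C := (abs_nonneg _).trans (hg0 _ hbs)
  have hmid : ∀ r ∈ Finset.range L, |(b (s + r) + b (s + r + 1)) / 2| ≤ R := by
    intro r hr
    have hr' := Finset.mem_range.1 hr
    have h1 := abs_le.1 (hb (s + r) (by omega))
    have h2 := abs_le.1 (hb (s + r + 1) (by omega))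
    rw [abs_le]
    constructor <;> linarith [h1.1, h1.2, h2.1, h2.2]
  have hsplit : ∑ r ∈ Finset.range L, g ((b (s + r) + b (s + r + 1)) / 2) * incr b (s + r) ^ 5
      = g (b s) * blockSum b L s + deriv g (b s) * blockDev b L s
        + ∑ r ∈ Finset.range L, (g ((b (s + r) + b (s + r + 1)) / 2)
            - (g (b s) + deriv g (b s) * midDev b s r)) * incr b (s + r) ^ 5 := by
    rw [blockSum, blockDev, Finset.mul_sum, Finset.mul_sum, ← Finset.sum_add_distrib,
      ← Finset.sum_add_distrib]
    refine Finset.sum_congr rfl fun r _ => ?_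
    ring
  have hrem : |∑ r ∈ Finset.range L, (g ((b (s + r) + b (s + r + 1)) / 2)
      - (g (b s) + deriv g (b s) * midDev b s r)) * incr b (s + r) ^ 5| ≤ C * blockRem b L s := by
    rw [blockRem, Finset.mul_sum]
    refine (Finset.abs_sum_le_sum_abs _ _).trans (Finset.sum_le_sum fun r hr => ?_)
    have h := abs_sub_taylor_sum_le hg (m := 1) hg2 (hmid r hr) hbs
    simp only [Finset.sum_range_succ, Finset.sum_range_zero, iteratedDeriv_zero,
      iteratedDeriv_one, Nat.factorial] at h
    rw [abs_mul, abs_pow, ← mul_assoc]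
    refine mul_le_mul_of_nonneg_right (le_trans (le_of_eq ?_) (h.trans (le_of_eq ?_)))
      (by positivity)
    · congr 1
      push_cast
      rw [midDev]
      ring
    · rw [midDev, sq_abs]
  rw [hsplit]
  refine (abs_add_le _ _).trans ?_
  have h1 := (abs_add_le (g (b s) * blockSum b L s) (deriv g (b s) * blockDev b L s))
  rw [abs_mul, abs_mul] at h1
  have h2 := mul_le_mul_of_nonneg_right (hg0 _ hbs) (abs_nonneg (blockSum b L s))
  have h3 := mul_le_mul_of_nonneg_right (hg1 _ hbs) (abs_nonneg (blockDev b L s))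
  linarith

theorem abs_pow_five_le (y : ℝ) {τ : ℝ} (hτ : 0 < τ) : |y| ^ 5 ≤ τ + τ⁻¹ * y ^ 10 := by
  have h : y ^ 10 = (|y| ^ 5) ^ 2 := by
    rw [← pow_mul, Even.pow_abs (by decide)]
  rw [h]
  have h2 : τ + τ⁻¹ * (|y| ^ 5) ^ 2 - |y| ^ 5
      = τ⁻¹ * ((τ - |y| ^ 5 / 2) ^ 2 + 3 / 4 * (|y| ^ 5) ^ 2) := by
    field_simp
    ring
  have h3 : 0 ≤ τ⁻¹ * ((τ - |y| ^ 5 / 2) ^ 2 + 3 / 4 * (|y| ^ 5) ^ 2) := by positivity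
  linarith

/-- The error of the third-order midpoint expansion of a smooth function along a sequence is at
most a constant times `expansionError`. -/
theorem abs_expansion_le {f : ℝ → ℝ} (hf : ContDiff ℝ (⊤ : ℕ∞) f) {R C : ℝ}
    (h5 : ∀ y, |y| ≤ R → |iteratedDeriv 5 f y| ≤ C)
    (h6 : ∀ y, |y| ≤ R → |iteratedDeriv 6 f y| ≤ C)
    (h7 : ∀ y, |y| ≤ R → |iteratedDeriv 7 f y| ≤ C) {b : ℕ → ℝ} {L N K : ℕ} {τ : ℝ}
    (hτ : 0 < τ) (hL : 0 < L) (hKN : K ≤ N) (hb : ∀ i ≤ N, |b i| ≤ R) :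
    |f (b K) - f (b 0) - ∑ i ∈ Finset.range K, (deriv f ((b i + b (i + 1)) / 2) * incr b i
        + (1 / 24) * iteratedDeriv 3 f ((b i + b (i + 1)) / 2) * incr b i ^ 3)|
      ≤ C * expansionError b L N τ := by
  set g : ℝ → ℝ := iteratedDeriv 5 f with hgdef
  have hg : ContDiff ℝ (⊤ : ℕ∞) g := by
    rw [hgdef, iteratedDeriv_eq_iterate]
    exact hf.iterate_deriv 5
  have hg1 : deriv g = iteratedDeriv 6 f := by rw [hgdef, ← iteratedDeriv_succ]
  have hg2 : iteratedDeriv 2 g = iteratedDeriv 7 f := by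
    rw [iteratedDeriv_succ, iteratedDeriv_one, hg1, ← iteratedDeriv_succ]
  have hC0 : 0 ≤ C := (abs_nonneg _).trans (h5 _ (hb 0 (Nat.zero_le _)))
  have hsum : f (b K) - f (b 0) - ∑ i ∈ Finset.range K,
        (deriv f ((b i + b (i + 1)) / 2) * incr b i
        + (1 / 24) * iteratedDeriv 3 f ((b i + b (i + 1)) / 2) * incr b i ^ 3)
      = ∑ i ∈ Finset.range K, (f (b (i + 1)) - f (b i)
          - (deriv f ((b i + b (i + 1)) / 2) * incr b i
            + (1 / 24) * iteratedDeriv 3 f ((b i + b (i + 1)) / 2) * incr b i ^ 3)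
          - g ((b i + b (i + 1)) / 2) / 1920 * incr b i ^ 5)
        + (∑ i ∈ Finset.range K, g ((b i + b (i + 1)) / 2) * incr b i ^ 5) / 1920 := by
    rw [Finset.sum_div, ← Finset.sum_add_distrib,
      ← Finset.sum_range_sub (fun i => f (b i)) K, ← Finset.sum_sub_distrib]
    refine Finset.sum_congr rfl fun i _ => ?_
    ring
  have hA : |∑ i ∈ Finset.range K, (f (b (i + 1)) - f (b i)
          - (deriv f ((b i + b (i + 1)) / 2) * incr b i
            + (1 / 24) * iteratedDeriv 3 f ((b i + b (i + 1)) / 2) * incr b i ^ 3)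
          - g ((b i + b (i + 1)) / 2) / 1920 * incr b i ^ 5)|
      ≤ C * ∑ i ∈ Finset.range N, |incr b i| ^ 7 := by
    refine (Finset.abs_sum_le_sum_abs _ _).trans ?_
    rw [Finset.mul_sum]
    refine (Finset.sum_le_sum (g := fun i => C * |incr b i| ^ 7) fun i hi => ?_).trans
      (Finset.sum_le_sum_of_subset_of_nonneg (Finset.range_subset_range.2 hKN)
        fun _ _ _ => by positivity)
    have hi' := Finset.mem_range.1 hi
    exact abs_midpoint_expansion_le hf h7 (hb i (by omega)) (hb (i + 1) (by omega))
  have hB : |∑ i ∈ Finset.range K, g ((b i + b (i + 1)) / 2) * incr b i ^ 5|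
      ≤ C * (∑ q ∈ Finset.range (N / L),
        (|blockSum b L (q * L)| + |blockDev b L (q * L)| + blockRem b L (q * L))
      + (L * τ + τ⁻¹ * ∑ i ∈ Finset.range N, incr b i ^ 10)) := by
    refine (abs_sum_range_le_blocks _ L K).trans ?_
    rw [mul_add, Finset.mul_sum]
    have hdivle : K / L ≤ N / L := Nat.div_le_div_right hKN
    have hKeq : K / L * L + K % L = K := by rw [mul_comm]; exact Nat.div_add_mod K L
    refine add_le_add ?_ ?_
    · refine (Finset.sum_le_sum (g := fun q => C * (|blockSum b L (q * L)|
          + |blockDev b L (q * L)| + blockRem b L (q * L))) fun q hq => ?_).trans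
        (Finset.sum_le_sum_of_subset_of_nonneg (Finset.range_subset_range.2 hdivle)
          fun _ _ _ => ?_)
      · have hq' : q * L + L ≤ N := by
          have : q + 1 ≤ K / L := Finset.mem_range.1 hq
          have := Nat.mul_le_mul_right L this
          rw [Nat.succ_mul] at this
          omega
        exact abs_block_sum_le hg h5 (by rwa [hg1]) (by rwa [hg2]) fun i hi => hb i (by omega)
      · have : 0 ≤ blockRem b L (‹ℕ› * L) := Finset.sum_nonneg fun _ _ => by positivity
        positivity
    · have hmod : K % L < L := Nat.mod_lt K hL
      have h1 : ∀ r ∈ Finset.range (K % L),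
          |g ((b (K / L * L + r) + b (K / L * L + r + 1)) / 2) * incr b (K / L * L + r) ^ 5|
            ≤ C * τ + C * τ⁻¹ * incr b (K / L * L + r) ^ 10 := by
        intro r hr
        have hr' := Finset.mem_range.1 hr
        have h1 := abs_le.1 (hb (K / L * L + r) (by omega))
        have h2 := abs_le.1 (hb (K / L * L + r + 1) (by omega))
        have hm : |(b (K / L * L + r) + b (K / L * L + r + 1)) / 2| ≤ R := by
          rw [abs_le]
          constructor <;> linarith [h1.1, h1.2, h2.1, h2.2]
        rw [abs_mul, abs_pow]
        calc _ ≤ C * (τ + τ⁻¹ * incr b (K / L * L + r) ^ 10) :=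
              mul_le_mul (h5 _ hm) (abs_pow_five_le _ hτ) (by positivity) hC0
          _ = _ := by ring
      refine (Finset.sum_le_sum h1).trans ?_
      rw [Finset.sum_add_distrib, mul_add, Finset.sum_const, Finset.card_range, nsmul_eq_mul,
        ← Finset.mul_sum]
      refine add_le_add ?_ ?_
      · have : ((K % L : ℕ) : ℝ) ≤ L := by exact_mod_cast hmod.le
        have h3 := mul_le_mul_of_nonneg_right this (mul_nonneg hC0 hτ.le)
        linarith
      · rw [mul_assoc]
        refine mul_le_mul_of_nonneg_left (mul_le_mul_of_nonneg_left ?_ (by positivity)) hC0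
        have h4 : ∑ i ∈ Finset.range K, incr b i ^ 10 ≤ ∑ i ∈ Finset.range N, incr b i ^ 10 :=
          Finset.sum_le_sum_of_subset_of_nonneg (Finset.range_subset_range.2 hKN)
            fun _ _ _ => by positivity
        refine le_trans ?_ h4
        conv_rhs => rw [← hKeq]
        rw [Finset.sum_range_add]
        have : 0 ≤ ∑ i ∈ Finset.range (K / L * L), incr b i ^ 10 :=
          Finset.sum_nonneg fun _ _ => by positivity
        linarith
  rw [hsum, expansionError, mul_add]
  refine (abs_add_le _ _).trans (add_le_add hA ?_)
  rw [abs_div, abs_of_pos (by norm_num : (0 : ℝ) < 1920)]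
  exact (div_le_self (abs_nonneg _) (by norm_num)).trans hB

/-- All absolute moments of `F` are finite. -/
def HasMoments {Ω : Type*} [MeasurableSpace Ω] (F : Ω → ℝ) (μ : Measure Ω) : Prop :=
  ∀ p : ENNReal, p ≠ ⊤ → MemLp F p μ

namespace HasMoments

variable {Ω : Type*} [MeasurableSpace Ω] {μ : Measure Ω} {F G : Ω → ℝ}

theorem integrable (hF : HasMoments F μ) : Integrable F μ :=
  memLp_one_iff_integrable.1 (hF 1 (by simp))

theorem add (hF : HasMoments F μ) (hG : HasMoments G μ) : HasMoments (fun ω => F ω + G ω) μ :=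
  fun p hp => (hF p hp).add (hG p hp)

theorem sub (hF : HasMoments F μ) (hG : HasMoments G μ) : HasMoments (fun ω => F ω - G ω) μ :=
  fun p hp => (hF p hp).sub (hG p hp)

theorem abs (hF : HasMoments F μ) : HasMoments (fun ω => |F ω|) μ :=
  fun p hp => (hF p hp).abs

theorem const_mul (hF : HasMoments F μ) (c : ℝ) : HasMoments (fun ω => c * F ω) μ :=
  fun p hp => (hF p hp).const_mul c

theorem const [IsFiniteMeasure μ] (c : ℝ) : HasMoments (fun _ : Ω => c) μ :=
  fun _ _ => memLp_const c

theorem mul (hF : HasMoments F μ) (hG : HasMoments G μ) : HasMoments (fun ω => F ω * G ω) μ := by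
  intro p hp
  have : ENNReal.HolderTriple (2 * p) (2 * p) p := ⟨by
    rw [ENNReal.mul_inv (by simp) (by simp), ← add_mul, ENNReal.inv_two_add_inv_two, one_mul]⟩
  exact MemLp.mul (hG (2 * p) (ENNReal.mul_ne_top (by simp) hp))
    (hF (2 * p) (ENNReal.mul_ne_top (by simp) hp))

theorem pow [IsFiniteMeasure μ] (hF : HasMoments F μ) (k : ℕ) :
    HasMoments (fun ω => F ω ^ k) μ := by
  induction k with
  | zero => simpa using HasMoments.const (μ := μ) 1
  | succ k ih => simpa [pow_succ] using ih.mul hF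

theorem sum [IsFiniteMeasure μ] {ι : Type*} (s : Finset ι) {F : ι → Ω → ℝ}
    (hF : ∀ i ∈ s, HasMoments (F i) μ) : HasMoments (fun ω => ∑ i ∈ s, F i ω) μ :=
  fun p hp => memLp_finsetSum s fun i hi => hF i hi p hp

end HasMoments

theorem integrable_eval_gaussianReal (v : NNReal) (P : Polynomial ℝ) :
    Integrable (fun x => P.eval x) (gaussianReal 0 v) := by
  have hid : HasMoments (fun x : ℝ => x) (gaussianReal 0 v) :=
    fun p hp => memLp_id_gaussianReal' p hp
  simp_rw [Polynomial.eval_eq_sum_range]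
  exact (HasMoments.sum _ fun i _ => (hid.pow i).const_mul _).integrable

theorem integrable_gaussianPDFReal_mul_eval {v : NNReal} (hv : v ≠ 0) (P : Polynomial ℝ) :
    Integrable (fun x => gaussianPDFReal 0 v x * P.eval x) := by
  have h := integrable_eval_gaussianReal v P
  rw [gaussianReal_of_var_ne_zero _ hv,
    integrable_withDensity_iff_integrable_smul' (measurable_gaussianPDF _ _)
      (ae_of_all _ fun _ => gaussianPDF_lt_top)] at h
  simpa [toReal_gaussianPDF] using h

/-- Stein's identity for polynomials. -/
theorem integral_mul_eval_gaussianReal (v : NNReal) (P : Polynomial ℝ) :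
    ∫ x, x * P.eval x ∂(gaussianReal 0 v) =
      v * ∫ x, P.derivative.eval x ∂(gaussianReal 0 v) := by
  rcases eq_or_ne v 0 with rfl | hv
  · simp [gaussianReal_zero_var]
  have hv' : (v : ℝ) ≠ 0 := by exact_mod_cast hv
  have hpdf : ∀ x, HasDerivAt (gaussianPDFReal 0 v) (-(x / v) * gaussianPDFReal 0 v x) x := by
    intro x
    unfold gaussianPDFReal
    have h1 : HasDerivAt (fun x : ℝ => -(x - 0) ^ 2 / (2 * v)) (-(x / v)) x := by
      have := (((hasDerivAt_id x).sub_const 0).pow 2).neg.div_const (2 * (v : ℝ))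
      convert! this using 1
      simp
      field_simp
    have h2 := (h1.exp).const_mul (√(2 * Real.pi * v))⁻¹
    convert! h2 using 1
    ring
  have hint1 := integrable_gaussianPDFReal_mul_eval hv (Polynomial.X * P)
  have hint2 := integrable_gaussianPDFReal_mul_eval hv P.derivative
  have hint3 := integrable_gaussianPDFReal_mul_eval hv P
  have hibp := integral_mul_deriv_eq_deriv_mul_of_integrable
    (u := fun x => P.eval x) (u' := fun x => P.derivative.eval x)
    (v := gaussianPDFReal 0 v) (v' := fun x => -(x / v) * gaussianPDFReal 0 v x)
    (fun x _ => P.hasDerivAt x) (fun x _ => hpdf x)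
    (by
      refine (hint1.const_mul (-(v : ℝ)⁻¹)).congr (ae_of_all _ fun x => ?_)
      simp
      ring)
    (by
      refine hint2.congr (ae_of_all _ fun x => ?_)
      simp [mul_comm])
    (by
      refine hint3.congr (ae_of_all _ fun x => ?_)
      simp [mul_comm])
  rw [integral_gaussianReal_eq_integral_smul hv, integral_gaussianReal_eq_integral_smul hv]
  have e1 : ∫ x, gaussianPDFReal 0 v x • (x * P.eval x)
      = -(v : ℝ) * ∫ x, P.eval x * (-(x / v) * gaussianPDFReal 0 v x) := by
    rw [← integral_const_mul]
    congr 1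
    ext x
    simp only [smul_eq_mul]
    field_simp
  rw [e1, hibp]
  simp only [smul_eq_mul, mul_neg, neg_mul, neg_neg]
  congr 2
  ext x
  ring

/-- Stein's identity for a polynomial whose coefficients are independent of the Gaussian variable. -/
theorem integral_mul_eval_of_indepFun {Ω E : Type*} [MeasurableSpace Ω] [MeasurableSpace E]
    {μ : Measure Ω} [IsProbabilityMeasure μ] {X : Ω → ℝ} {W : Ω → E} {v : NNReal}
    (hX : Measurable X) (hW : Measurable W) (hlaw : μ.map X = gaussianReal 0 v)
    (hind : IndepFun X W μ) (P : E → Polynomial ℝ)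
    (hm : Measurable fun z : ℝ × E => (P z.2).eval z.1)
    (hm' : Measurable fun z : ℝ × E => (P z.2).derivative.eval z.1)
    (hi : Integrable (fun ω => X ω * (P (W ω)).eval (X ω)) μ)
    (hi' : Integrable (fun ω => (P (W ω)).derivative.eval (X ω)) μ) :
    ∫ ω, X ω * (P (W ω)).eval (X ω) ∂μ = v * ∫ ω, (P (W ω)).derivative.eval (X ω) ∂μ := by
  have hXW : Measurable fun ω => (X ω, W ω) := hX.prodMk hW
  have : IsProbabilityMeasure (μ.map W) := Measure.isProbabilityMeasure_map hW.aemeasurable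
  have hprod : μ.map (fun ω => (X ω, W ω)) = (gaussianReal 0 v).prod (μ.map W) := by
    rw [← hlaw]
    exact (indepFun_iff_map_prod_eq_prod_map_map hX.aemeasurable hW.aemeasurable).1 hind
  have key : ∀ G : ℝ × E → ℝ, Measurable G → Integrable (fun ω => G (X ω, W ω)) μ →
      ∫ ω, G (X ω, W ω) ∂μ = ∫ w, ∫ x, G (x, w) ∂(gaussianReal 0 v) ∂(μ.map W) := by
    intro G hG hGi
    have h1 : Integrable G ((gaussianReal 0 v).prod (μ.map W)) := by
      rw [← hprod, integrable_map_measure hG.aestronglyMeasurable hXW.aemeasurable]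
      exact hGi
    rw [← integral_prod_symm G h1, ← hprod,
      integral_map hXW.aemeasurable hG.aestronglyMeasurable]
  rw [key (fun z => z.1 * (P z.2).eval z.1) (measurable_fst.mul hm) hi,
    key (fun z => (P z.2).derivative.eval z.1) hm' hi', ← integral_const_mul]
  simp_rw [integral_mul_eval_gaussianReal]

/-- A linear space of centered, jointly Gaussian random variables. -/
def IsGaussianSpace {Ω : Type*} [MeasurableSpace Ω] (V : Submodule ℝ (Ω → ℝ)) (μ : Measure Ω) :
    Prop :=
  ∀ X ∈ V, Measurable X ∧ ∃ v : NNReal, μ.map X = gaussianReal 0 v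

namespace IsGaussianSpace

variable {Ω : Type*} [MeasurableSpace Ω] {V : Submodule ℝ (Ω → ℝ)} {μ : Measure Ω}

theorem hasMoments (hV : IsGaussianSpace V μ) {X : Ω → ℝ} (hX : X ∈ V) : HasMoments X μ := by
  intro p hp
  obtain ⟨hm, v, hv⟩ := hV X hX
  have h := memLp_id_gaussianReal' (μ := 0) (v := v) p hp
  rw [← hv, memLp_map_measure_iff aestronglyMeasurable_id hm.aemeasurable] at h
  exact h

theorem map_eq (hV : IsGaussianSpace V μ) {X : Ω → ℝ} (hX : X ∈ V) :
    ∃ v : NNReal, μ.map X = gaussianReal 0 v ∧ (v : ℝ) = ∫ ω, X ω * X ω ∂μ := by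
  obtain ⟨hm, v, hv⟩ := hV X hX
  refine ⟨v, hv, ?_⟩
  have h := integral_mul_eval_gaussianReal v Polynomial.X
  simp only [Polynomial.eval_X, Polynomial.derivative_X, Polynomial.eval_one, integral_const,
    probReal_univ, smul_eq_mul, mul_one] at h
  rw [← h, ← hv, integral_map hm.aemeasurable (by fun_prop)]

theorem integral_eq_zero (hV : IsGaussianSpace V μ) {X : Ω → ℝ} (hX : X ∈ V) :
    ∫ ω, X ω ∂μ = 0 := by
  obtain ⟨hm, v, hv⟩ := hV X hX
  rw [← integral_id_gaussianReal (μ := 0) (v := v), ← hv,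
    integral_map hm.aemeasurable (by fun_prop)]

theorem indepFun (hV : IsGaussianSpace V μ) [IsProbabilityMeasure μ] {κ : Type*} [Fintype κ]
    [DecidableEq κ] {X : Ω → ℝ} (hX : X ∈ V) {W : κ → Ω → ℝ} (hW : ∀ j, W j ∈ V)
    (h : ∀ j, ∫ ω, X ω * W j ω ∂μ = 0) : IndepFun X (fun ω j => W j ω) μ := by
  have hg : HasGaussianLaw (fun ω => ((fun _ : Unit => X ω), (fun j => W j ω))) μ := by
    refine ⟨isGaussian_of_map_eq_gaussianReal fun L => ?_⟩
    have hmeas : Measurable fun ω => ((fun _ : Unit => X ω), (fun j => W j ω)) :=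
      (measurable_pi_lambda _ fun _ => (hV X hX).1).prodMk
        (measurable_pi_lambda _ fun j => (hV (W j) (hW j)).1)
    rw [Measure.map_map L.continuous.measurable hmeas]
    have hmem : (L ∘ fun ω => ((fun _ : Unit => X ω), (fun j => W j ω))) ∈ V := by
      have heq : (L ∘ fun ω => ((fun _ : Unit => X ω), (fun j => W j ω))) =
          L ((fun _ => 1), 0) • X + ∑ j, L (0, Pi.single j 1) • W j := by
        ext ω
        have hdec : ((fun _ : Unit => X ω), (fun j => W j ω)) =
            X ω • ((fun _ => (1 : ℝ)), (0 : κ → ℝ))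
              + ∑ j, W j ω • ((0 : Unit → ℝ), (Pi.single j (1 : ℝ) : κ → ℝ)) := by
          refine Prod.ext ?_ ?_
          · ext
            simp [Prod.fst_sum]
          · ext k
            simp [Prod.snd_sum, Finset.sum_apply, Pi.single_apply]
        simp only [Function.comp_apply, Pi.add_apply, Finset.sum_apply, Pi.smul_apply, smul_eq_mul]
        rw [hdec, map_add, map_sum, map_smul]
        simp only [map_smul, smul_eq_mul]
        congr 1
        · ring
        · exact Finset.sum_congr rfl fun j _ => by ring
      rw [heq]
      exact V.add_mem (V.smul_mem _ hX) (V.sum_mem fun j _ => V.smul_mem _ (hW j))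
    obtain ⟨-, v, hv⟩ := hV _ hmem
    exact ⟨0, v, hv⟩
  have hind := HasGaussianLaw.indepFun_of_covariance_eval (X := fun _ : Unit => X) (Y := W) hg
    fun _ j => by
      rw [covariance_eq_sub (hV.hasMoments hX 2 (by simp)) (hV.hasMoments (hW j) 2 (by simp)),
        hV.integral_eq_zero hX, zero_mul, sub_zero]
      exact h j
  exact hind.comp (φ := fun x : Unit → ℝ => x ()) (ψ := id) (measurable_pi_apply _) measurable_id

/-- Gaussian integration by parts for monomials. -/
theorem integral_mul_monomial (hV : IsGaussianSpace V μ) [IsProbabilityMeasure μ]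
    {X Z U W : Ω → ℝ} (hX : X ∈ V) (hZ : Z ∈ V) (hU : U ∈ V) (hW : W ∈ V) (p q : ℕ) :
    ∫ ω, X ω * (Z ω * (U ω ^ p * W ω ^ q)) ∂μ =
      (∫ ω, X ω * Z ω ∂μ) * ∫ ω, U ω ^ p * W ω ^ q ∂μ
      + p * (∫ ω, X ω * U ω ∂μ) * ∫ ω, Z ω * (U ω ^ (p - 1) * W ω ^ q) ∂μ
      + q * (∫ ω, X ω * W ω ∂μ) * ∫ ω, Z ω * (U ω ^ p * W ω ^ (q - 1)) ∂μ := by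
  have mX := hV.hasMoments hX
  have mZ := hV.hasMoments hZ
  have mU := hV.hasMoments hU
  have mW := hV.hasMoments hW
  obtain ⟨v, hlaw, hv⟩ := hV.map_eq hX
  rcases eq_or_ne v 0 with rfl | hv0
  · have hX0 : X =ᵐ[μ] 0 := by
      have h0 : ∫ ω, X ω * X ω ∂μ = 0 := by rw [← hv]; rfl
      rw [integral_eq_zero_iff_of_nonneg (fun ω => mul_self_nonneg (X ω))
        (mX.mul mX).integrable] at h0
      filter_upwards [h0] with ω hω
      simpa using hω
    have hz : ∀ F : Ω → ℝ, ∫ ω, X ω * F ω ∂μ = 0 := by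
      intro F
      rw [integral_eq_zero_of_ae]
      filter_upwards [hX0] with ω hω
      simp [hω]
    rw [hz Z, hz U, hz W, hz fun ω => Z ω * (U ω ^ p * W ω ^ q)]
    simp
  have hv' : (v : ℝ) ≠ 0 := by exact_mod_cast hv0
  set a : ℝ := (∫ ω, X ω * Z ω ∂μ) / v with ha
  set b : ℝ := (∫ ω, X ω * U ω ∂μ) / v with hb
  set c : ℝ := (∫ ω, X ω * W ω ∂μ) / v with hc
  obtain ⟨S, hS0, hS1, hS2⟩ : ∃ S : Fin 3 → Ω → ℝ,
      S 0 = Z - a • X ∧ S 1 = U - b • X ∧ S 2 = W - c • X :=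
    ⟨![Z - a • X, U - b • X, W - c • X], rfl, rfl, rfl⟩
  have hS : ∀ j, S j ∈ V := by
    rw [Fin.forall_fin_succ, Fin.forall_fin_two]
    refine ⟨hS0 ▸ V.sub_mem hZ (V.smul_mem _ hX), ?_, ?_⟩
    · exact hS1 ▸ V.sub_mem hU (V.smul_mem _ hX)
    · exact hS2 ▸ V.sub_mem hW (V.smul_mem _ hX)
  have horth : ∀ (F : Ω → ℝ), HasMoments F μ →
      ∫ ω, X ω * (F - ((∫ ω, X ω * F ω ∂μ) / v) • X) ω ∂μ = 0 := by
    intro F hF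
    have e : ∀ ω, X ω * (F - ((∫ ω, X ω * F ω ∂μ) / v) • X) ω
        = X ω * F ω - ((∫ ω, X ω * F ω ∂μ) / v) * (X ω * X ω) := by
      intro ω
      simp only [Pi.sub_apply, Pi.smul_apply, smul_eq_mul]
      ring
    simp_rw [e]
    rw [integral_sub (mX.mul hF).integrable ((mX.mul mX).const_mul _).integrable,
      integral_const_mul, ← hv]
    field_simp
    ring
  have hind : IndepFun X (fun ω j => S j ω) μ := by
    refine hV.indepFun hX hS ?_
    rw [Fin.forall_fin_succ, Fin.forall_fin_two]
    refine ⟨hS0 ▸ horth Z mZ, ?_, ?_⟩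
    · exact hS1 ▸ horth U mU
    · exact hS2 ▸ horth W mW
  obtain ⟨P, hP, hP'⟩ : ∃ P : (Fin 3 → ℝ) → Polynomial ℝ,
      (∀ w x, (P w).eval x = (a * x + w 0) * ((b * x + w 1) ^ p * (c * x + w 2) ^ q)) ∧
      ∀ w x, (P w).derivative.eval x =
        a * ((b * x + w 1) ^ p * (c * x + w 2) ^ q)
        + p * b * ((a * x + w 0) * ((b * x + w 1) ^ (p - 1) * (c * x + w 2) ^ q))
        + q * c * ((a * x + w 0) * ((b * x + w 1) ^ p * (c * x + w 2) ^ (q - 1))) := by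
    refine ⟨fun w => (Polynomial.C a * Polynomial.X + Polynomial.C (w 0)) *
      ((Polynomial.C b * Polynomial.X + Polynomial.C (w 1)) ^ p *
        (Polynomial.C c * Polynomial.X + Polynomial.C (w 2)) ^ q), fun w x => by simp,
        fun w x => ?_⟩
    simp [Polynomial.derivative_pow]
    ring
  have eZ : ∀ ω, a * X ω + S 0 ω = Z ω := fun ω => by simp [hS0]
  have eU : ∀ ω, b * X ω + S 1 ω = U ω := fun ω => by simp [hS1]
  have eW : ∀ ω, c * X ω + S 2 ω = W ω := fun ω => by simp [hS2]
  have m1 := (mU.pow p).mul (mW.pow q)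
  have m2 := mZ.mul ((mU.pow (p - 1)).mul (mW.pow q))
  have m3 := mZ.mul ((mU.pow p).mul (mW.pow (q - 1)))
  have key := integral_mul_eval_of_indepFun (hV X hX).1
    (measurable_pi_lambda _ fun j => (hV _ (hS j)).1) hlaw hind P
    (by simp_rw [hP]; fun_prop) (by simp_rw [hP']; fun_prop)
    (by
      simp_rw [hP, eZ, eU, eW]
      exact (mX.mul (mZ.mul m1)).integrable)
    (by
      simp_rw [hP', eZ, eU, eW]
      exact (((m1.const_mul _).add (m2.const_mul _)).add (m3.const_mul _)).integrable)
  simp_rw [hP, hP', eZ, eU, eW] at key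
  rw [key, integral_add ((m1.const_mul _).add (m2.const_mul _)).integrable
    (m3.const_mul _).integrable, integral_add (m1.const_mul _).integrable
    (m2.const_mul _).integrable, integral_const_mul, integral_const_mul, integral_const_mul,
    ha, hb, hc]
  field_simp

end IsGaussianSpace

theorem abs_pow_mul_abs_pow_le (y z : ℝ) (a b : ℕ) :
    |y| ^ a * |z| ^ b ≤ |y| ^ (a + b) + |z| ^ (a + b) := by
  have hy := abs_nonneg y
  have hz := abs_nonneg z
  rcases le_total |y| |z| with h | h
  · calc |y| ^ a * |z| ^ b ≤ |z| ^ a * |z| ^ b := by gcongr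
      _ = |z| ^ (a + b) := (pow_add _ _ _).symm
      _ ≤ _ := le_add_of_nonneg_left (by positivity)
  · calc |y| ^ a * |z| ^ b ≤ |y| ^ a * |y| ^ b := by gcongr
      _ = |y| ^ (a + b) := (pow_add _ _ _).symm
      _ ≤ _ := le_add_of_nonneg_right (by positivity)

theorem mul_le_weighted_sq (s t : ℝ) {c : ℝ} (hc : 0 < c) :
    s * t ≤ (c * s ^ 2 + c⁻¹ * t ^ 2) / 2 := by
  have h : (c * s ^ 2 + c⁻¹ * t ^ 2) / 2 - s * t = c⁻¹ * (c * s - t) ^ 2 / 2 := by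
    field_simp
    ring
  have : 0 ≤ c⁻¹ * (c * s - t) ^ 2 / 2 := by positivity
  linarith

namespace IsGaussianSpace

variable {Ω : Type*} [MeasurableSpace Ω] {V : Submodule ℝ (Ω → ℝ)} {μ : Measure Ω}
  [IsProbabilityMeasure μ] {X X' Y Z : Ω → ℝ} {x u : ℝ}

theorem integral_pow_add_two (hV : IsGaussianSpace V μ) (hY : Y ∈ V) (k : ℕ) :
    ∫ ω, Y ω ^ (k + 2) ∂μ = (k + 1) * (∫ ω, Y ω * Y ω ∂μ) * ∫ ω, Y ω ^ k ∂μ := by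
  have h := hV.integral_mul_monomial hY hY hY hY k 0
  have e1 : ∀ ω, Y ω * (Y ω * (Y ω ^ k * Y ω ^ 0)) = Y ω ^ (k + 2) := fun ω => by ring
  simp_rw [e1] at h
  rw [h]
  rcases k with _ | k
  · simp
  · have e2 : ∀ ω, Y ω * (Y ω ^ (k + 1 - 1) * Y ω ^ 0) = Y ω ^ (k + 1) := fun ω => by
      simp only [Nat.add_sub_cancel]
      ring
    simp_rw [e2]
    simp
    ring

theorem integral_even_pow_le (hV : IsGaussianSpace V μ) (hY : Y ∈ V)
    (hu : ∫ ω, Y ω * Y ω ∂μ ≤ u ^ 2) (k : ℕ) :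
    ∫ ω, Y ω ^ (2 * k) ∂μ ≤ (2 * k).factorial * u ^ (2 * k) := by
  induction k with
  | zero => simp
  | succ k ih =>
    have h0 : 0 ≤ ∫ ω, Y ω * Y ω ∂μ := integral_nonneg fun ω => mul_self_nonneg _
    have hu0 : 0 ≤ u ^ (2 * k) := by rw [pow_mul]; positivity
    have hI : 0 ≤ ∫ ω, Y ω ^ (2 * k) ∂μ :=
      integral_nonneg fun ω => by simp only [Pi.zero_apply, pow_mul]; positivity
    rw [show 2 * (k + 1) = 2 * k + 2 by ring, hV.integral_pow_add_two hY]
    calc ((2 * k : ℕ) + 1 : ℝ) * (∫ ω, Y ω * Y ω ∂μ) * ∫ ω, Y ω ^ (2 * k) ∂μ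
        ≤ ((2 * k : ℕ) + 1 : ℝ) * u ^ 2 * ((2 * k).factorial * u ^ (2 * k)) := by gcongr
      _ ≤ ((2 * k : ℕ) + 2 : ℝ) * (((2 * k : ℕ) + 1 : ℝ) * u ^ 2 *
            ((2 * k).factorial * u ^ (2 * k))) := by
          refine le_mul_of_one_le_left (by positivity) ?_
          have : (0 : ℝ) ≤ (2 * k : ℕ) := by positivity
          linarith
      _ = _ := by
          rw [Nat.factorial_succ, Nat.factorial_succ]
          push_cast
          ring

theorem abs_integral_pow_mul_pow_le (hV : IsGaussianSpace V μ) (hY : Y ∈ V) (hZ : Z ∈ V)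
    (hYu : ∫ ω, Y ω * Y ω ∂μ ≤ u ^ 2) (hZu : ∫ ω, Z ω * Z ω ∂μ ≤ u ^ 2) {a b k : ℕ}
    (hab : a + b = 2 * k) :
    |∫ ω, Y ω ^ a * Z ω ^ b ∂μ| ≤ 2 * (2 * k).factorial * u ^ (2 * k) := by
  have mY := hV.hasMoments hY
  have mZ := hV.hasMoments hZ
  have heven : Even (2 * k) := even_two_mul k
  calc |∫ ω, Y ω ^ a * Z ω ^ b ∂μ| ≤ ∫ ω, |Y ω ^ a * Z ω ^ b| ∂μ := abs_integral_le_integral_abs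
    _ ≤ ∫ ω, (Y ω ^ (2 * k) + Z ω ^ (2 * k)) ∂μ := by
        refine integral_mono ((mY.pow a).mul (mZ.pow b)).abs.integrable
          ((mY.pow _).add (mZ.pow _)).integrable fun ω => ?_
        have h := abs_pow_mul_abs_pow_le (Y ω) (Z ω) a b
        rw [hab, heven.pow_abs, heven.pow_abs] at h
        simpa [abs_mul, abs_pow] using h
    _ = ∫ ω, Y ω ^ (2 * k) ∂μ + ∫ ω, Z ω ^ (2 * k) ∂μ :=
        integral_add (mY.pow _).integrable (mZ.pow _).integrable
    _ ≤ _ := by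
        have h1 := hV.integral_even_pow_le hY hYu k
        have h2 := hV.integral_even_pow_le hZ hZu k
        linarith

theorem integral_abs_pow_seven_le (hV : IsGaussianSpace V μ) (hY : Y ∈ V) (hu0 : 0 < u)
    (hYu : ∫ ω, Y ω * Y ω ∂μ ≤ u ^ 2) : ∫ ω, |Y ω| ^ 7 ∂μ ≤ 10 ^ 5 * u ^ 7 := by
  have mY := hV.hasMoments hY
  calc ∫ ω, |Y ω| ^ 7 ∂μ ≤ ∫ ω, (u / 2 * Y ω ^ 6 + u⁻¹ / 2 * Y ω ^ 8) ∂μ := by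
        refine integral_mono (mY.abs.pow 7).integrable
          (((mY.pow 6).const_mul _).add ((mY.pow 8).const_mul _)).integrable fun ω => ?_
        have h := mul_le_weighted_sq (|Y ω| ^ 3) (|Y ω| ^ 4) hu0
        have e6 : (|Y ω| ^ 3) ^ 2 = Y ω ^ 6 := by rw [← pow_mul, Even.pow_abs (by decide)]
        have e8 : (|Y ω| ^ 4) ^ 2 = Y ω ^ 8 := by rw [← pow_mul, Even.pow_abs (by decide)]
        rw [← pow_add, e6, e8] at h
        refine h.trans_eq ?_
        ring
    _ = u / 2 * ∫ ω, Y ω ^ 6 ∂μ + u⁻¹ / 2 * ∫ ω, Y ω ^ 8 ∂μ := by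
        rw [integral_add ((mY.pow 6).const_mul _).integrable ((mY.pow 8).const_mul _).integrable,
          integral_const_mul, integral_const_mul]
    _ ≤ u / 2 * ((2 * 3).factorial * u ^ (2 * 3)) + u⁻¹ / 2 * ((2 * 4).factorial * u ^ (2 * 4)) := by
        gcongr
        · exact hV.integral_even_pow_le hY hYu 3
        · exact hV.integral_even_pow_le hY hYu 4
    _ ≤ 10 ^ 5 * u ^ 7 := by
        have : u⁻¹ / 2 * ((2 * 4).factorial * u ^ (2 * 4)) = (2 * 4).factorial / 2 * u ^ 7 := by
          field_simp
        rw [this]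
        have : 0 ≤ u ^ 7 := by positivity
        norm_num [Nat.factorial]
        nlinarith

theorem integral_sq_mul_abs_pow_five_le (hV : IsGaussianSpace V μ) (hX : X ∈ V) (hY : Y ∈ V)
    (hx0 : 0 < x) (hu0 : 0 < u) (hXx : ∫ ω, X ω * X ω ∂μ ≤ x ^ 2)
    (hYu : ∫ ω, Y ω * Y ω ∂μ ≤ u ^ 2) :
    ∫ ω, X ω ^ 2 * |Y ω| ^ 5 ∂μ ≤ 10 ^ 7 * (x ^ 2 * u ^ 5) := by
  have mX := hV.hasMoments hX
  have mY := hV.hasMoments hY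
  calc ∫ ω, X ω ^ 2 * |Y ω| ^ 5 ∂μ
      ≤ ∫ ω, (u ^ 5 / x ^ 2 / 2 * X ω ^ 4 + (u ^ 5 / x ^ 2)⁻¹ / 2 * Y ω ^ 10) ∂μ := by
        refine integral_mono ((mX.pow 2).mul (mY.abs.pow 5)).integrable
          (((mX.pow 4).const_mul _).add ((mY.pow 10).const_mul _)).integrable fun ω => ?_
        have h := mul_le_weighted_sq (X ω ^ 2) (|Y ω| ^ 5) (show 0 < u ^ 5 / x ^ 2 by positivity)
        have e10 : (|Y ω| ^ 5) ^ 2 = Y ω ^ 10 := by rw [← pow_mul, Even.pow_abs (by decide)]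
        rw [e10] at h
        refine h.trans_eq ?_
        ring
    _ = u ^ 5 / x ^ 2 / 2 * ∫ ω, X ω ^ 4 ∂μ + (u ^ 5 / x ^ 2)⁻¹ / 2 * ∫ ω, Y ω ^ 10 ∂μ := by
        rw [integral_add ((mX.pow 4).const_mul _).integrable ((mY.pow 10).const_mul _).integrable,
          integral_const_mul, integral_const_mul]
    _ ≤ u ^ 5 / x ^ 2 / 2 * ((2 * 2).factorial * x ^ (2 * 2))
          + (u ^ 5 / x ^ 2)⁻¹ / 2 * ((2 * 5).factorial * u ^ (2 * 5)) := by
        gcongr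
        · exact hV.integral_even_pow_le hX hXx 2
        · exact hV.integral_even_pow_le hY hYu 5
    _ = ((2 * 2).factorial + (2 * 5).factorial) / 2 * (x ^ 2 * u ^ 5) := by
        field_simp
        ring
    _ ≤ _ := by
        gcongr
        norm_num [Nat.factorial]

theorem integral_abs_mul_pow_mul_pow_le (hV : IsGaussianSpace V μ) (hX : X ∈ V) (hY : Y ∈ V)
    (hZ : Z ∈ V) (hx0 : 0 < x) (hu0 : 0 < u) (hXx : ∫ ω, X ω * X ω ∂μ ≤ x ^ 2)
    (hYu : ∫ ω, Y ω * Y ω ∂μ ≤ u ^ 2) (hZu : ∫ ω, Z ω * Z ω ∂μ ≤ u ^ 2) {a b : ℕ}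
    (hab : a + b = 9) :
    |∫ ω, X ω * (Y ω ^ a * Z ω ^ b) ∂μ| ≤ 10 ^ 16 * (x * u ^ 9) := by
  have mX := hV.hasMoments hX
  have mY := hV.hasMoments hY
  have mZ := hV.hasMoments hZ
  calc |∫ ω, X ω * (Y ω ^ a * Z ω ^ b) ∂μ| ≤ ∫ ω, |X ω * (Y ω ^ a * Z ω ^ b)| ∂μ :=
        abs_integral_le_integral_abs
    _ ≤ ∫ ω, (u ^ 9 / x / 2 * X ω ^ 2 + (u ^ 9 / x)⁻¹ / 2 * (Y ω ^ 18 + Z ω ^ 18)) ∂μ := by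
        refine integral_mono (mX.mul ((mY.pow a).mul (mZ.pow b))).abs.integrable
          (((mX.pow 2).const_mul _).add (((mY.pow 18).add (mZ.pow 18)).const_mul _)).integrable
          fun ω => ?_
        have h := mul_le_weighted_sq |X ω| (|Y ω| ^ a * |Z ω| ^ b)
          (show 0 < u ^ 9 / x by positivity)
        have h2 := abs_pow_mul_abs_pow_le (Y ω) (Z ω) (a * 2) (b * 2)
        have e18 : ∀ y : ℝ, |y| ^ (9 * 2) = y ^ 18 := fun y => by rw [Even.pow_abs (by decide)]
        rw [← add_mul, hab, e18, e18] at h2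
        rw [mul_pow, sq_abs, ← pow_mul, ← pow_mul] at h
        have h3 := mul_le_mul_of_nonneg_left h2 (show 0 ≤ (u ^ 9 / x)⁻¹ by positivity)
        rw [abs_mul, abs_mul, abs_pow, abs_pow]
        linarith
    _ = u ^ 9 / x / 2 * ∫ ω, X ω * X ω ∂μ
          + (u ^ 9 / x)⁻¹ / 2 * (∫ ω, Y ω ^ 18 ∂μ + ∫ ω, Z ω ^ 18 ∂μ) := by
        rw [integral_add ((mX.pow 2).const_mul _).integrable
          (((mY.pow 18).add (mZ.pow 18)).const_mul _).integrable,
          integral_const_mul, integral_const_mul,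
          integral_add (mY.pow 18).integrable (mZ.pow 18).integrable]
        simp_rw [pow_two]
    _ ≤ u ^ 9 / x / 2 * x ^ 2 + (u ^ 9 / x)⁻¹ / 2 *
          ((2 * 9).factorial * u ^ (2 * 9) + (2 * 9).factorial * u ^ (2 * 9)) := by
        gcongr
        · exact hV.integral_even_pow_le hY hYu 9
        · exact hV.integral_even_pow_le hZ hZu 9
    _ = (1 / 2 + (2 * 9).factorial) * (x * u ^ 9) := by
        field_simp
        ring
    _ ≤ _ := by
        gcongr
        norm_num [Nat.factorial]

theorem abs_integral_pow_five_mul_pow_five_le (hV : IsGaussianSpace V μ) (hY : Y ∈ V)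
    (hZ : Z ∈ V) (hYu : ∫ ω, Y ω * Y ω ∂μ ≤ u ^ 2) (hZu : ∫ ω, Z ω * Z ω ∂μ ≤ u ^ 2) :
    |∫ ω, Y ω ^ 5 * Z ω ^ 5 ∂μ| ≤ 10 ^ 6 * (u ^ 8 * |∫ ω, Y ω * Z ω ∂μ|) := by
  have h55 := hV.integral_mul_monomial hY hZ hY hZ 4 4
  have h35 := hV.integral_mul_monomial hY hZ hY hZ 2 4
  have h15 := hV.integral_mul_monomial hY hZ hY hZ 0 4
  have e1 : ∀ ω, Y ω * (Z ω * (Y ω ^ 4 * Z ω ^ 4)) = Y ω ^ 5 * Z ω ^ 5 := fun ω => by ring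
  have e2 : ∀ ω, Z ω * (Y ω ^ (4 - 1) * Z ω ^ 4) = Y ω ^ 3 * Z ω ^ 5 := fun ω => by norm_num; ring
  have e3 : ∀ ω, Z ω * (Y ω ^ 4 * Z ω ^ (4 - 1)) = Y ω ^ 4 * Z ω ^ 4 := fun ω => by norm_num; ring
  have e4 : ∀ ω, Y ω * (Z ω * (Y ω ^ 2 * Z ω ^ 4)) = Y ω ^ 3 * Z ω ^ 5 := fun ω => by ring
  have e5 : ∀ ω, Z ω * (Y ω ^ (2 - 1) * Z ω ^ 4) = Y ω ^ 1 * Z ω ^ 5 := fun ω => by norm_num; ring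
  have e6 : ∀ ω, Z ω * (Y ω ^ 2 * Z ω ^ (4 - 1)) = Y ω ^ 2 * Z ω ^ 4 := fun ω => by norm_num; ring
  have e7 : ∀ ω, Y ω * (Z ω * (Y ω ^ 0 * Z ω ^ 4)) = Y ω ^ 1 * Z ω ^ 5 := fun ω => by ring
  have e8 : ∀ ω, Z ω * (Y ω ^ 0 * Z ω ^ (4 - 1)) = Y ω ^ 0 * Z ω ^ 4 := fun ω => by norm_num; ring
  simp_rw [e1, e2, e3] at h55
  simp_rw [e4, e5, e6] at h35
  simp_rw [e7, e8] at h15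
  have b44 := hV.abs_integral_pow_mul_pow_le hY hZ hYu hZu (a := 4) (b := 4) (k := 4) rfl
  have b24 := hV.abs_integral_pow_mul_pow_le hY hZ hYu hZu (a := 2) (b := 4) (k := 3) rfl
  have b04 := hV.abs_integral_pow_mul_pow_le hY hZ hYu hZu (a := 0) (b := 4) (k := 2) rfl
  have hv0 : 0 ≤ ∫ ω, Y ω * Y ω ∂μ := integral_nonneg fun ω => mul_self_nonneg _
  set c := ∫ ω, Y ω * Z ω ∂μ
  set v := ∫ ω, Y ω * Y ω ∂μ
  set A := ∫ ω, Y ω ^ 4 * Z ω ^ 4 ∂μ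
  set B := ∫ ω, Y ω ^ 2 * Z ω ^ 4 ∂μ
  set D := ∫ ω, Y ω ^ 0 * Z ω ^ 4 ∂μ
  have hval : ∫ ω, Y ω ^ 5 * Z ω ^ 5 ∂μ = c * (5 * A + 20 * (v * B) + 40 * (v ^ 2 * D)) := by
    rw [h55, h35, h15]
    push_cast
    ring
  have hvB : |v * B| ≤ u ^ 2 * (2 * (2 * 3).factorial * u ^ (2 * 3)) := by
    rw [abs_mul, abs_of_nonneg hv0]
    gcongr
  have hvD : |v ^ 2 * D| ≤ (u ^ 2) ^ 2 * (2 * (2 * 2).factorial * u ^ (2 * 2)) := by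
    rw [abs_mul, abs_of_nonneg (by positivity)]
    gcongr
  rw [hval, abs_mul, show 10 ^ 6 * (u ^ 8 * |c|) = |c| * (10 ^ 6 * u ^ 8) by ring]
  refine mul_le_mul_of_nonneg_left ?_ (abs_nonneg c)
  have h8 : 0 ≤ u ^ 8 := by positivity
  have f4 : (2 * (2 * 4).factorial * u ^ (2 * 4) : ℝ) = 80640 * u ^ 8 := by norm_num [Nat.factorial]
  have f3 : u ^ 2 * (2 * (2 * 3).factorial * u ^ (2 * 3)) = 1440 * u ^ 8 := by
    norm_num [Nat.factorial]
    ring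
  have f2 : (u ^ 2) ^ 2 * (2 * (2 * 2).factorial * u ^ (2 * 2)) = 48 * u ^ 8 := by
    norm_num [Nat.factorial]
    ring
  rw [f4] at b44
  rw [f3] at hvB
  rw [f2] at hvD
  obtain ⟨a1, a2⟩ := abs_le.1 b44
  obtain ⟨a3, a4⟩ := abs_le.1 hvB
  obtain ⟨a5, a6⟩ := abs_le.1 hvD
  rw [abs_le]
  constructor <;> linarith

theorem abs_integral_mul_pow_five_le (hV : IsGaussianSpace V μ) (hX : X ∈ V) (hX' : X' ∈ V)
    (hY : Y ∈ V) (hZ : Z ∈ V) (hx0 : 0 < x) (hu0 : 0 < u) (hX'x : ∫ ω, X' ω * X' ω ∂μ ≤ x ^ 2)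
    (hYu : ∫ ω, Y ω * Y ω ∂μ ≤ u ^ 2) (hZu : ∫ ω, Z ω * Z ω ∂μ ≤ u ^ 2)
    (hXX' : |∫ ω, X ω * X' ω ∂μ| ≤ x ^ 2) :
    |∫ ω, X ω * (X' ω * (Y ω ^ 5 * Z ω ^ 5)) ∂μ| ≤
      10 ^ 17 * (x ^ 2 * u ^ 8 * |∫ ω, Y ω * Z ω ∂μ|
        + x * u ^ 9 * (|∫ ω, X ω * Y ω ∂μ| + |∫ ω, X ω * Z ω ∂μ|)) := by
  rw [hV.integral_mul_monomial hX hX' hY hZ 5 5]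
  have h1 := hV.abs_integral_pow_five_mul_pow_five_le hY hZ hYu hZu
  have h2 := hV.integral_abs_mul_pow_mul_pow_le hX' hY hZ hx0 hu0 hX'x hYu hZu
    (a := 5 - 1) (b := 5) rfl
  have h3 := hV.integral_abs_mul_pow_mul_pow_le hX' hY hZ hx0 hu0 hX'x hYu hZu
    (a := 5) (b := 5 - 1) rfl
  refine (abs_add_le _ _).trans ((add_le_add ((abs_add_le _ _).trans (add_le_add
    ((abs_mul _ _).trans_le (mul_le_mul hXX' h1 (abs_nonneg _) (by positivity)))
    ((abs_mul _ _).trans_le (mul_le_mul_of_nonneg_left h2 (abs_nonneg _)))))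
    ((abs_mul _ _).trans_le (mul_le_mul_of_nonneg_left h3 (abs_nonneg _)))).trans ?_)
  rw [abs_mul, abs_mul]
  push_cast
  rw [abs_of_pos (by norm_num : (0 : ℝ) < 5)]
  have p1 : 0 ≤ x ^ 2 * u ^ 8 * |∫ ω, Y ω * Z ω ∂μ| := by positivity
  have p2 : 0 ≤ x * u ^ 9 * |∫ ω, X ω * Y ω ∂μ| := by positivity
  have p3 : 0 ≤ x * u ^ 9 * |∫ ω, X ω * Z ω ∂μ| := by positivity
  nlinarith

end IsGaussianSpace

/-- The cube root of the distance between two natural numbers. -/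
def cbrtDist (i j : ℕ) : ℝ := |(i : ℝ) - j| ^ ((1 : ℝ) / 3)

theorem cbrtDist_nonneg (i j : ℕ) : 0 ≤ cbrtDist i j := by unfold cbrtDist; positivity

theorem cbrtDist_comm (i j : ℕ) : cbrtDist i j = cbrtDist j i := by
  rw [cbrtDist, cbrtDist, abs_sub_comm]

theorem cbrtDist_add_left (s i j : ℕ) : cbrtDist (s + i) (s + j) = cbrtDist i j := by
  simp [cbrtDist]

theorem cbrtDist_self (i : ℕ) : cbrtDist i i = 0 := by
  simp [cbrtDist]

theorem cbrtDist_zero_one : cbrtDist 0 1 = 1 := by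
  simp [cbrtDist]

theorem cbrtDist_self_add (i m : ℕ) : cbrtDist i (i + m) = cbrtDist 0 m := by
  simpa using cbrtDist_add_left i 0 m

theorem cbrtDist_zero_left (m : ℕ) : cbrtDist 0 m = (m : ℝ) ^ ((1 : ℝ) / 3) := by
  simp [cbrtDist]

theorem cbrtDist_zero_mono {m n : ℕ} (h : m ≤ n) : cbrtDist 0 m ≤ cbrtDist 0 n := by
  rw [cbrtDist_zero_left, cbrtDist_zero_left]
  gcongr

theorem cbrtDist_zero_pow_six (l : ℕ) : cbrtDist 0 (l ^ 6) = (l : ℝ) ^ 2 := by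
  rw [cbrtDist_zero_left, Nat.cast_pow, ← Real.rpow_natCast, ← Real.rpow_mul (by positivity),
    ← Real.rpow_natCast]
  norm_num

theorem cbrtDist_zero_concave (m : ℕ) :
    cbrtDist 0 m + cbrtDist 0 (m + 2) ≤ 2 * cbrtDist 0 (m + 1) := by
  have h := (Real.concaveOn_rpow (p := 1 / 3) (by norm_num) (by norm_num)).2
    (show (m : ℝ) ∈ Set.Ici 0 from Set.mem_Ici.2 (Nat.cast_nonneg m))
    (show ((m + 2 : ℕ) : ℝ) ∈ Set.Ici 0 from Set.mem_Ici.2 (Nat.cast_nonneg _))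
    (show (0 : ℝ) ≤ 1 / 2 by norm_num) (show (0 : ℝ) ≤ 1 / 2 by norm_num) (by norm_num)
  have e : (1 / 2 : ℝ) • (m : ℝ) + (1 / 2 : ℝ) • ((m + 2 : ℕ) : ℝ) = ((m + 1 : ℕ) : ℝ) := by
    simp only [smul_eq_mul]
    push_cast
    ring
  rw [e] at h
  simp only [smul_eq_mul] at h
  rw [cbrtDist_zero_left, cbrtDist_zero_left, cbrtDist_zero_left]
  linarith

theorem sum_abs_cbrtDist_sub_le {r L : ℕ} (hr : r ≤ L) :
    ∑ k ∈ Finset.range L, |cbrtDist r (k + 1) - cbrtDist r k| ≤ 2 * cbrtDist 0 L := by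
  obtain ⟨d, rfl⟩ := Nat.exists_eq_add_of_le hr
  rw [Finset.sum_range_add]
  have h1 : ∑ k ∈ Finset.range r, |cbrtDist r (k + 1) - cbrtDist r k| = cbrtDist 0 r := by
    have e : ∀ k ∈ Finset.range r, |cbrtDist r (k + 1) - cbrtDist r k|
        = cbrtDist r k - cbrtDist r (k + 1) := by
      intro k hk
      obtain ⟨m, rfl⟩ := Nat.exists_eq_add_of_lt (Finset.mem_range.1 hk)
      have e1 := cbrtDist_self_add (k + 1) m
      have e2 := cbrtDist_self_add k (m + 1)
      rw [cbrtDist_comm, show k + 1 + m = k + m + 1 by ring] at e1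
      rw [cbrtDist_comm, show k + (m + 1) = k + m + 1 by ring] at e2
      rw [abs_of_nonpos, neg_sub]
      rw [e1, e2]
      linarith [cbrtDist_zero_mono m.le_succ]
    rw [Finset.sum_congr rfl e, Finset.sum_range_sub', cbrtDist_self, sub_zero, cbrtDist_comm]
  have h2 : ∑ k ∈ Finset.range d, |cbrtDist r (r + k + 1) - cbrtDist r (r + k)|
      = cbrtDist 0 d := by
    have e : ∀ k ∈ Finset.range d, |cbrtDist r (r + k + 1) - cbrtDist r (r + k)|
        = cbrtDist 0 (k + 1) - cbrtDist 0 k := by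
      intro k _
      rw [add_assoc, cbrtDist_self_add, cbrtDist_self_add, abs_of_nonneg]
      linarith [cbrtDist_zero_mono k.le_succ]
    rw [Finset.sum_congr rfl e, Finset.sum_range_sub, cbrtDist_self, sub_zero]
  rw [h1, h2]
  linarith [cbrtDist_zero_mono (Nat.le_add_right r d), cbrtDist_zero_mono (Nat.le_add_left d r)]

theorem sum_abs_cbrtDist_second_diff_le (r L : ℕ) :
    ∑ k ∈ Finset.range L, |cbrtDist (r + 1) k + cbrtDist r (k + 1) - 2 * cbrtDist r k| ≤ 4 := by
  have hshift : ∀ i j, cbrtDist (i + 1) (j + 1) = cbrtDist i j := fun i j => by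
    rw [add_comm i, add_comm j, cbrtDist_add_left]
  set h : ℕ → ℝ := fun k => cbrtDist (r + 1) k - cbrtDist r k with hh
  have hc : ∀ k, cbrtDist (r + 1) k + cbrtDist r (k + 1) - 2 * cbrtDist r k
      = h k - h (k + 1) := fun k => by
    simp only [hh, hshift]
    ring
  have hsucc : cbrtDist (r + 1) r = 1 := by
    rw [cbrtDist_comm, cbrtDist_self_add, cbrtDist_zero_one]
  have hr : h r = 1 := by simp only [hh, hsucc, cbrtDist_self, sub_zero]
  have hr1 : h (r + 1) = -1 := by
    simp only [hh, cbrtDist_self, cbrtDist_self_add, cbrtDist_zero_one, zero_sub]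
  simp_rw [hc]
  have hsub : ∑ k ∈ Finset.range L, |h k - h (k + 1)|
      ≤ ∑ k ∈ Finset.range (r + 1 + L), |h k - h (k + 1)| :=
    Finset.sum_le_sum_of_subset_of_nonneg (Finset.range_mono (by omega))
      fun _ _ _ => abs_nonneg _
  refine hsub.trans ?_
  rw [Finset.sum_range_add, Finset.sum_range_succ, hr, hr1]
  have h1 : ∑ k ∈ Finset.range r, |h k - h (k + 1)| ≤ 1 := by
    have e : ∀ k ∈ Finset.range r, |h k - h (k + 1)| = h (k + 1) - h k := by
      intro k hk
      obtain ⟨m, rfl⟩ := Nat.exists_eq_add_of_lt (Finset.mem_range.1 hk)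
      have e0 := cbrtDist_self_add k (m + 2)
      have e1 := cbrtDist_self_add k (m + 1)
      have e2 := cbrtDist_self_add k m
      have e3 := cbrtDist_zero_concave m
      rw [abs_of_nonpos, neg_sub]
      simp only [hh, hshift]
      rw [show k + m + 1 + 1 = k + (m + 2) by ring, show k + m + 1 = k + (m + 1) by ring,
        cbrtDist_comm (k + (m + 2)), cbrtDist_comm (k + (m + 1)), cbrtDist_comm (k + m), e0, e1, e2]
      linarith
    rw [Finset.sum_congr rfl e, Finset.sum_range_sub, hr]
    have : 0 ≤ h 0 := by
      simp only [hh]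
      rw [cbrtDist_comm, cbrtDist_comm r]
      linarith [cbrtDist_zero_mono r.le_succ]
    linarith
  have h2 : ∑ k ∈ Finset.range L, |h (r + 1 + k) - h (r + 1 + k + 1)| ≤ 1 := by
    have hval : ∀ k, h (r + 1 + k) = cbrtDist 0 k - cbrtDist 0 (k + 1) := fun k => by
      simp only [hh]
      rw [cbrtDist_self_add, add_right_comm, add_assoc, cbrtDist_self_add]
    have e : ∀ k ∈ Finset.range L, |h (r + 1 + k) - h (r + 1 + k + 1)|
        = h (r + 1 + (k + 1)) - h (r + 1 + k) := by
      intro k _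
      rw [add_assoc (r + 1), hval, hval, abs_of_nonpos]
      · ring
      · linarith [cbrtDist_zero_concave k]
    rw [Finset.sum_congr rfl e, Finset.sum_range_sub (fun k => h (r + 1 + k)), add_zero, hr1, hval]
    linarith [cbrtDist_zero_mono L.le_succ]
  have h3 : |(1 : ℝ) - -1| = 2 := by norm_num
  rw [h3]
  linarith

theorem incr_mem {Ω : Type*} {V : Submodule ℝ (Ω → ℝ)} {b : ℕ → Ω → ℝ}
    (hmem : ∀ i, b i ∈ V) (i : ℕ) : (fun ω => incr (fun i => b i ω) i) ∈ V :=
  V.sub_mem (hmem (i + 1)) (hmem i)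

theorem midDev_mem {Ω : Type*} {V : Submodule ℝ (Ω → ℝ)} {b : ℕ → Ω → ℝ}
    (hmem : ∀ i, b i ∈ V) (s r : ℕ) :
    (fun ω => midDev (fun i => b i ω) s r) ∈ V := by
  have h := V.sub_mem (V.smul_mem (1 / 2) (V.add_mem (hmem (s + r)) (hmem (s + r + 1)))) (hmem s)
  convert h using 1
  ext ω
  simp [midDev]
  ring

/-- The random sequence `b` has the covariance structure of a fractional Brownian motion with
Hurst parameter `1/6` sampled along a grid, with increments of variance `u ^ 2`. -/
def HasCbrtCov {Ω : Type*} [MeasurableSpace Ω] (b : ℕ → Ω → ℝ) (u : ℝ) (μ : Measure Ω) : Prop :=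
  ∀ i j k l, ∫ ω, (b i ω - b j ω) * (b k ω - b l ω) ∂μ =
    u ^ 2 / 2 * (cbrtDist i l + cbrtDist j k - cbrtDist i k - cbrtDist j l)

namespace HasCbrtCov

variable {Ω : Type*} [MeasurableSpace Ω] {V : Submodule ℝ (Ω → ℝ)} {μ : Measure Ω}
  {b : ℕ → Ω → ℝ} {u : ℝ}

theorem integral_incr_mul_incr (hb : HasCbrtCov b u μ) (s r k : ℕ) :
    ∫ ω, incr (fun i => b i ω) (s + r) * incr (fun i => b i ω) (s + k) ∂μ =
      u ^ 2 / 2 * (cbrtDist (r + 1) k + cbrtDist r (k + 1) - 2 * cbrtDist r k) := by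
  simp only [incr]
  rw [hb, add_assoc, add_assoc, cbrtDist_add_left, cbrtDist_add_left, cbrtDist_add_left,
    cbrtDist_add_left, add_comm r 1, add_comm k 1, cbrtDist_add_left]
  ring

theorem integral_incr_mul_self (hb : HasCbrtCov b u μ) (i : ℕ) :
    ∫ ω, incr (fun i => b i ω) i * incr (fun i => b i ω) i ∂μ = u ^ 2 := by
  have h := hb.integral_incr_mul_incr 0 i i
  simp only [zero_add] at h
  rw [h, cbrtDist_self, cbrtDist_comm, cbrtDist_self_add, cbrtDist_zero_one]
  ring

theorem sum_abs_integral_incr_mul_incr_le (hb : HasCbrtCov b u μ) (s r L : ℕ) :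
    ∑ k ∈ Finset.range L,
      |∫ ω, incr (fun i => b i ω) (s + r) * incr (fun i => b i ω) (s + k) ∂μ| ≤ 2 * u ^ 2 := by
  simp_rw [hb.integral_incr_mul_incr, abs_mul]
  rw [← Finset.mul_sum, abs_of_nonneg (by positivity)]
  have := mul_le_mul_of_nonneg_left (sum_abs_cbrtDist_second_diff_le r L)
    (show 0 ≤ u ^ 2 / 2 by positivity)
  linarith

theorem integral_midDev_mul_self_le (hb : HasCbrtCov b u μ) (hV : IsGaussianSpace V μ)
    (hmem : ∀ i, b i ∈ V) {s r L : ℕ} (hr : r < L) :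
    ∫ ω, midDev (fun i => b i ω) s r * midDev (fun i => b i ω) s r ∂μ ≤
      u ^ 2 * cbrtDist 0 L := by
  have hm : ∀ i j, HasMoments (fun ω => (b i ω - b j ω) * (b i ω - b j ω)) μ := fun i j =>
    ((hV.hasMoments (hmem i)).sub (hV.hasMoments (hmem j))).mul
      ((hV.hasMoments (hmem i)).sub (hV.hasMoments (hmem j)))
  have hval : ∀ m, ∫ ω, (b (s + m) ω - b s ω) * (b (s + m) ω - b s ω) ∂μ
      = u ^ 2 * cbrtDist 0 m := fun m => by
    rw [hb, cbrtDist_self, cbrtDist_self, cbrtDist_comm, cbrtDist_self_add]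
    ring
  calc ∫ ω, midDev (fun i => b i ω) s r * midDev (fun i => b i ω) s r ∂μ
      ≤ ∫ ω, (1 / 2 * ((b (s + r) ω - b s ω) * (b (s + r) ω - b s ω))
          + 1 / 2 * ((b (s + (r + 1)) ω - b s ω) * (b (s + (r + 1)) ω - b s ω))) ∂μ := by
        have mM := hV.hasMoments (midDev_mem hmem s r)
        refine integral_mono (mM.mul mM).integrable
          (((hm _ _).const_mul _).add ((hm _ _).const_mul _)).integrable fun ω => ?_
        simp only [midDev]
        rw [← add_assoc]
        nlinarith [sq_nonneg (b (s + r) ω - b (s + r + 1) ω)]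
    _ = 1 / 2 * (u ^ 2 * cbrtDist 0 r) + 1 / 2 * (u ^ 2 * cbrtDist 0 (r + 1)) := by
        rw [integral_add ((hm _ _).const_mul _).integrable ((hm _ _).const_mul _).integrable,
          integral_const_mul, integral_const_mul, hval, hval]
    _ ≤ u ^ 2 * cbrtDist 0 L := by
        have h1 := mul_le_mul_of_nonneg_left (cbrtDist_zero_mono hr.le) (sq_nonneg u)
        have h2 := mul_le_mul_of_nonneg_left (cbrtDist_zero_mono hr) (sq_nonneg u)
        linarith

theorem abs_integral_midDev_mul_midDev_le (hb : HasCbrtCov b u μ) (hV : IsGaussianSpace V μ)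
    (hmem : ∀ i, b i ∈ V) {s j k L : ℕ} (hj : j < L) (hk : k < L) :
    |∫ ω, midDev (fun i => b i ω) s j * midDev (fun i => b i ω) s k ∂μ| ≤
      u ^ 2 * cbrtDist 0 L := by
  have mj := hV.hasMoments (midDev_mem hmem s j)
  have mk := hV.hasMoments (midDev_mem hmem s k)
  have h1 := hb.integral_midDev_mul_self_le hV hmem (s := s) hj
  have h2 := hb.integral_midDev_mul_self_le hV hmem (s := s) hk
  refine abs_integral_le_integral_abs.trans ?_
  calc ∫ ω, |midDev (fun i => b i ω) s j * midDev (fun i => b i ω) s k| ∂μ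
      ≤ ∫ ω, (1 / 2 * (midDev (fun i => b i ω) s j * midDev (fun i => b i ω) s j)
          + 1 / 2 * (midDev (fun i => b i ω) s k * midDev (fun i => b i ω) s k)) ∂μ := by
        refine integral_mono (mj.mul mk).abs.integrable
          (((mj.mul mj).const_mul _).add ((mk.mul mk).const_mul _)).integrable fun ω => ?_
        rw [abs_le]
        constructor
        · nlinarith [sq_nonneg (midDev (fun i => b i ω) s j + midDev (fun i => b i ω) s k)]
        · nlinarith [sq_nonneg (midDev (fun i => b i ω) s j - midDev (fun i => b i ω) s k)]
    _ = 1 / 2 * ∫ ω, midDev (fun i => b i ω) s j * midDev (fun i => b i ω) s j ∂μ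
          + 1 / 2 * ∫ ω, midDev (fun i => b i ω) s k * midDev (fun i => b i ω) s k ∂μ := by
        rw [integral_add ((mj.mul mj).const_mul _).integrable ((mk.mul mk).const_mul _).integrable,
          integral_const_mul, integral_const_mul]
    _ ≤ _ := by linarith

theorem integral_midDev_mul_incr (hb : HasCbrtCov b u μ) (hV : IsGaussianSpace V μ)
    (hmem : ∀ i, b i ∈ V) (s r k : ℕ) :
    ∫ ω, midDev (fun i => b i ω) s r * incr (fun i => b i ω) (s + k) ∂μ =
      u ^ 2 / 4 * (2 * (cbrtDist 0 (k + 1) - cbrtDist 0 k)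
        - (cbrtDist r (k + 1) - cbrtDist r k) - (cbrtDist (r + 1) (k + 1) - cbrtDist (r + 1) k)) := by
  have hm : ∀ m, HasMoments (fun ω => (b (s + m) ω - b s ω) * (b (s + k + 1) ω - b (s + k) ω)) μ :=
    fun m => ((hV.hasMoments (hmem _)).sub (hV.hasMoments (hmem _))).mul
      ((hV.hasMoments (hmem _)).sub (hV.hasMoments (hmem _)))
  have e : ∀ ω, midDev (fun i => b i ω) s r * incr (fun i => b i ω) (s + k)
      = 1 / 2 * ((b (s + r) ω - b s ω) * (b (s + k + 1) ω - b (s + k) ω))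
        + 1 / 2 * ((b (s + (r + 1)) ω - b s ω) * (b (s + k + 1) ω - b (s + k) ω)) := fun ω => by
    simp only [midDev, incr]
    rw [← add_assoc s r 1]
    ring
  simp_rw [e]
  rw [integral_add ((hm _).const_mul _).integrable ((hm _).const_mul _).integrable,
    integral_const_mul, integral_const_mul, hb, hb, add_assoc s k 1]
  simp only [cbrtDist_add_left, cbrtDist_self_add]
  ring

theorem sum_abs_integral_midDev_mul_incr_le (hb : HasCbrtCov b u μ) (hV : IsGaussianSpace V μ)
    (hmem : ∀ i, b i ∈ V) {s r L : ℕ} (hr : r < L) :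
    ∑ k ∈ Finset.range L,
      |∫ ω, midDev (fun i => b i ω) s r * incr (fun i => b i ω) (s + k) ∂μ| ≤
        2 * (u ^ 2 * cbrtDist 0 L) := by
  have hle : ∀ k, |∫ ω, midDev (fun i => b i ω) s r * incr (fun i => b i ω) (s + k) ∂μ|
      ≤ u ^ 2 / 4 * (2 * |cbrtDist 0 (k + 1) - cbrtDist 0 k|
        + |cbrtDist r (k + 1) - cbrtDist r k|
        + |cbrtDist (r + 1) (k + 1) - cbrtDist (r + 1) k|) := by
    intro k
    rw [hb.integral_midDev_mul_incr hV hmem, abs_mul, abs_of_nonneg (by positivity)]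
    refine mul_le_mul_of_nonneg_left ?_ (by positivity)
    refine (abs_sub _ _).trans (add_le_add ((abs_sub _ _).trans (add_le_add ?_ le_rfl)) le_rfl)
    rw [abs_mul, abs_of_pos two_pos]
  refine (Finset.sum_le_sum fun k _ => hle k).trans ?_
  rw [← Finset.mul_sum, Finset.sum_add_distrib, Finset.sum_add_distrib, ← Finset.mul_sum]
  have h0 := sum_abs_cbrtDist_sub_le (Nat.zero_le L)
  have h1 := sum_abs_cbrtDist_sub_le hr.le
  have h2 := sum_abs_cbrtDist_sub_le (Nat.succ_le_of_lt hr)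
  calc _ ≤ u ^ 2 / 4 * (2 * (2 * cbrtDist 0 L) + 2 * cbrtDist 0 L + 2 * cbrtDist 0 L) := by
        gcongr
    _ = _ := by ring

theorem sum_abs_integral_midDev_mul_incr_self_le (hb : HasCbrtCov b u μ)
    (hV : IsGaussianSpace V μ) (hmem : ∀ i, b i ∈ V) (s L : ℕ) :
    ∑ k ∈ Finset.range L,
      |∫ ω, midDev (fun i => b i ω) s k * incr (fun i => b i ω) (s + k) ∂μ| ≤
        u ^ 2 * cbrtDist 0 L := by
  have hval : ∀ k, |∫ ω, midDev (fun i => b i ω) s k * incr (fun i => b i ω) (s + k) ∂μ|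
      = u ^ 2 / 2 * (cbrtDist 0 (k + 1) - cbrtDist 0 k) := by
    intro k
    rw [hb.integral_midDev_mul_incr hV hmem, cbrtDist_self, cbrtDist_self,
      cbrtDist_comm (k + 1) k]
    have := cbrtDist_zero_mono k.le_succ
    rw [abs_of_nonneg]
    · ring
    · refine mul_nonneg (by positivity) ?_
      linarith
  simp_rw [hval]
  rw [← Finset.mul_sum, Finset.sum_range_sub, cbrtDist_self]
  have : 0 ≤ u ^ 2 * cbrtDist 0 L := mul_nonneg (sq_nonneg u) (cbrtDist_nonneg _ _)
  linarith

end HasCbrtCov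

section Moments

variable {Ω : Type*} [MeasurableSpace Ω] {μ : Measure Ω} [IsProbabilityMeasure μ]

theorem HasMoments.integral_abs_le {F : Ω → ℝ} (hF : HasMoments F μ) {M s : ℝ} (hs : 0 < s)
    (hM : ∫ ω, F ω ^ 2 ∂μ ≤ M) : ∫ ω, |F ω| ∂μ ≤ (M / s + s) / 2 := by
  calc ∫ ω, |F ω| ∂μ ≤ ∫ ω, (s⁻¹ / 2 * F ω ^ 2 + s / 2) ∂μ := by
        refine integral_mono hF.abs.integrable
          (((hF.pow 2).const_mul _).add (HasMoments.const _)).integrable fun ω => ?_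
        have h := mul_le_weighted_sq |F ω| 1 (inv_pos.2 hs)
        rw [mul_one, sq_abs, inv_inv] at h
        refine h.trans_eq ?_
        ring
    _ = s⁻¹ / 2 * ∫ ω, F ω ^ 2 ∂μ + s / 2 := by
        rw [integral_add ((hF.pow 2).const_mul _).integrable (HasMoments.const _).integrable,
          integral_const_mul, integral_const]
        simp
    _ ≤ s⁻¹ / 2 * M + s / 2 := by gcongr
    _ = _ := by ring

theorem integral_sq_sum_le {ι : Type*} (s : Finset ι) {F : ι → Ω → ℝ}
    (hF : ∀ i ∈ s, HasMoments (F i) μ) :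
    ∫ ω, (∑ i ∈ s, F i ω) ^ 2 ∂μ ≤ ∑ i ∈ s, ∑ j ∈ s, |∫ ω, F i ω * F j ω ∂μ| := by
  simp_rw [sq, Finset.sum_mul_sum]
  rw [integral_finsetSum _ fun i hi =>
    (HasMoments.sum s fun j hj => (hF i hi).mul (hF j hj)).integrable]
  refine Finset.sum_le_sum fun i hi => ?_
  rw [integral_finsetSum _ fun j hj => ((hF i hi).mul (hF j hj)).integrable]
  exact Finset.sum_le_sum fun j _ => le_abs_self _

end Moments

namespace HasCbrtCov

variable {Ω : Type*} [MeasurableSpace Ω] {V : Submodule ℝ (Ω → ℝ)} {μ : Measure Ω}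
  [IsProbabilityMeasure μ] {b : ℕ → Ω → ℝ} {u : ℝ}

theorem hasMoments_blockSum (hV : IsGaussianSpace V μ) (hmem : ∀ i, b i ∈ V) (L s : ℕ) :
    HasMoments (fun ω => blockSum (fun i => b i ω) L s) μ :=
  HasMoments.sum _ fun _ _ => (hV.hasMoments (incr_mem hmem _)).pow 5

theorem hasMoments_blockDev (hV : IsGaussianSpace V μ) (hmem : ∀ i, b i ∈ V) (L s : ℕ) :
    HasMoments (fun ω => blockDev (fun i => b i ω) L s) μ :=
  HasMoments.sum _ fun _ _ =>
    (hV.hasMoments (midDev_mem hmem _ _)).mul ((hV.hasMoments (incr_mem hmem _)).pow 5)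

theorem hasMoments_blockRem (hV : IsGaussianSpace V μ) (hmem : ∀ i, b i ∈ V) (L s : ℕ) :
    HasMoments (fun ω => blockRem (fun i => b i ω) L s) μ :=
  HasMoments.sum _ fun _ _ =>
    ((hV.hasMoments (midDev_mem hmem _ _)).pow 2).mul
      ((hV.hasMoments (incr_mem hmem _)).abs.pow 5)

theorem integral_abs_blockSum_le (hb : HasCbrtCov b u μ) (hV : IsGaussianSpace V μ)
    (hmem : ∀ i, b i ∈ V) (hu : 0 < u) {l : ℕ} (hl : 0 < l) (s : ℕ) :
    ∫ ω, |blockSum (fun i => b i ω) (l ^ 6) s| ∂μ ≤ 10 ^ 7 * (u ^ 5 * l ^ 3) := by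
  have hl' : (0 : ℝ) < l := by exact_mod_cast hl
  have hsq : ∫ ω, blockSum (fun i => b i ω) (l ^ 6) s ^ 2 ∂μ ≤ 10 ^ 6 * (2 * u ^ 10 * l ^ 6) := by
    refine (integral_sq_sum_le _ fun r _ => (hV.hasMoments (incr_mem hmem (s + r))).pow 5).trans ?_
    have hr : ∀ r ∈ Finset.range (l ^ 6), ∑ k ∈ Finset.range (l ^ 6),
        |∫ ω, incr (fun i => b i ω) (s + r) ^ 5 * incr (fun i => b i ω) (s + k) ^ 5 ∂μ|
          ≤ 10 ^ 6 * (u ^ 8 * (2 * u ^ 2)) := by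
      intro r _
      refine (Finset.sum_le_sum fun k _ => hV.abs_integral_pow_five_mul_pow_five_le
        (incr_mem hmem _) (incr_mem hmem _) (hb.integral_incr_mul_self _).le
        (hb.integral_incr_mul_self _).le).trans ?_
      rw [← Finset.mul_sum, ← Finset.mul_sum]
      have := hb.sum_abs_integral_incr_mul_incr_le s r (l ^ 6)
      gcongr
    refine (Finset.sum_le_sum hr).trans_eq ?_
    simp only [Finset.sum_const, Finset.card_range, nsmul_eq_mul]
    push_cast
    ring
  refine ((hasMoments_blockSum hV hmem _ s).integral_abs_le
    (show 0 < u ^ 5 * (l : ℝ) ^ 3 by positivity) hsq).trans ?_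
  have e : (10 : ℝ) ^ 6 * (2 * u ^ 10 * l ^ 6) / (u ^ 5 * l ^ 3)
      = 10 ^ 6 * 2 * (u ^ 5 * l ^ 3) := by
    field_simp
  rw [e]
  have : 0 < u ^ 5 * (l : ℝ) ^ 3 := by positivity
  linarith

theorem integral_abs_blockDev_le (hb : HasCbrtCov b u μ) (hV : IsGaussianSpace V μ)
    (hmem : ∀ i, b i ∈ V) (hu : 0 < u) {l : ℕ} (hl : 0 < l) (s : ℕ) :
    ∫ ω, |blockDev (fun i => b i ω) (l ^ 6) s| ∂μ ≤ 10 ^ 18 * (u ^ 6 * l ^ 5) := by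
  have hl' : (1 : ℝ) ≤ l := by exact_mod_cast hl
  have hg : u ^ 2 * cbrtDist 0 (l ^ 6) = (u * l) ^ 2 := by
    rw [cbrtDist_zero_pow_six]
    ring
  have hsq : ∫ ω, blockDev (fun i => b i ω) (l ^ 6) s ^ 2 ∂μ ≤
      10 ^ 17 * (2 * u ^ 12 * l ^ 8 + 3 * u ^ 12 * l ^ 9) := by
    refine (integral_sq_sum_le _ fun r _ => (hV.hasMoments (midDev_mem hmem s r)).mul
      ((hV.hasMoments (incr_mem hmem (s + r))).pow 5)).trans ?_
    have hjk : ∀ j ∈ Finset.range (l ^ 6), ∀ k ∈ Finset.range (l ^ 6),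
        |∫ ω, midDev (fun i => b i ω) s j * incr (fun i => b i ω) (s + j) ^ 5 *
          (midDev (fun i => b i ω) s k * incr (fun i => b i ω) (s + k) ^ 5) ∂μ| ≤
        10 ^ 17 * ((u * l) ^ 2 * u ^ 8 *
            |∫ ω, incr (fun i => b i ω) (s + j) * incr (fun i => b i ω) (s + k) ∂μ|
          + u * l * u ^ 9 *
            (|∫ ω, midDev (fun i => b i ω) s j * incr (fun i => b i ω) (s + j) ∂μ|
              + |∫ ω, midDev (fun i => b i ω) s j * incr (fun i => b i ω) (s + k) ∂μ|)) := by
      intro j hj k hk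
      have h := hV.abs_integral_mul_pow_five_le (midDev_mem hmem s j) (midDev_mem hmem s k)
        (incr_mem hmem (s + j)) (incr_mem hmem (s + k)) (x := u * l) (by positivity) hu
        (hg ▸ hb.integral_midDev_mul_self_le hV hmem (Finset.mem_range.1 hk))
        (hb.integral_incr_mul_self _).le (hb.integral_incr_mul_self _).le
        (hg ▸ hb.abs_integral_midDev_mul_midDev_le hV hmem (Finset.mem_range.1 hj)
          (Finset.mem_range.1 hk))
      refine le_trans (le_of_eq ?_) h
      congr 2
      ext ω
      ring
    refine (Finset.sum_le_sum fun j hj => Finset.sum_le_sum fun k hk => hjk j hj k hk).trans ?_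
    simp_rw [← Finset.mul_sum, Finset.sum_add_distrib, ← Finset.mul_sum, Finset.sum_add_distrib]
    have h1 : ∑ j ∈ Finset.range (l ^ 6), ∑ k ∈ Finset.range (l ^ 6),
        |∫ ω, incr (fun i => b i ω) (s + j) * incr (fun i => b i ω) (s + k) ∂μ|
        ≤ l ^ 6 * (2 * u ^ 2) := by
      refine (Finset.sum_le_sum fun j _ =>
        hb.sum_abs_integral_incr_mul_incr_le s j (l ^ 6)).trans_eq ?_
      simp
    have h2 : ∑ j ∈ Finset.range (l ^ 6), ∑ _k ∈ Finset.range (l ^ 6),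
        |∫ ω, midDev (fun i => b i ω) s j * incr (fun i => b i ω) (s + j) ∂μ|
        ≤ l ^ 6 * (u * l) ^ 2 := by
      simp only [Finset.sum_const, Finset.card_range, nsmul_eq_mul]
      rw [← Finset.mul_sum, Nat.cast_pow, ← hg]
      exact mul_le_mul_of_nonneg_left
        (hb.sum_abs_integral_midDev_mul_incr_self_le hV hmem s (l ^ 6)) (by positivity)
    have h3 : ∑ j ∈ Finset.range (l ^ 6), ∑ k ∈ Finset.range (l ^ 6),
        |∫ ω, midDev (fun i => b i ω) s j * incr (fun i => b i ω) (s + k) ∂μ|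
        ≤ l ^ 6 * (2 * (u * l) ^ 2) := by
      refine (Finset.sum_le_sum fun j hj => hb.sum_abs_integral_midDev_mul_incr_le hV hmem
        (Finset.mem_range.1 hj)).trans_eq ?_
      rw [hg]
      simp
    calc _ ≤ 10 ^ 17 * ((u * l) ^ 2 * u ^ 8 * (l ^ 6 * (2 * u ^ 2))
          + u * l * u ^ 9 * (l ^ 6 * (u * l) ^ 2 + l ^ 6 * (2 * (u * l) ^ 2))) := by gcongr
      _ = _ := by ring
  refine ((hasMoments_blockDev hV hmem _ s).integral_abs_le
    (show 0 < u ^ 6 * (l : ℝ) ^ 5 by positivity) hsq).trans ?_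
  have e : (10 : ℝ) ^ 17 * (2 * u ^ 12 * l ^ 8 + 3 * u ^ 12 * l ^ 9) / (u ^ 6 * l ^ 5)
      = 10 ^ 17 * (u ^ 6 * l ^ 3 * 2 + u ^ 6 * l ^ 4 * 3) := by
    field_simp
  rw [e]
  have h3 : u ^ 6 * (l : ℝ) ^ 3 ≤ u ^ 6 * (l : ℝ) ^ 5 := by gcongr; norm_num
  have h4 : u ^ 6 * (l : ℝ) ^ 4 ≤ u ^ 6 * (l : ℝ) ^ 5 := by gcongr; norm_num
  have : 0 < u ^ 6 * (l : ℝ) ^ 5 := by positivity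
  linarith

theorem integral_blockRem_le (hb : HasCbrtCov b u μ) (hV : IsGaussianSpace V μ)
    (hmem : ∀ i, b i ∈ V) (hu : 0 < u) {l : ℕ} (hl : 0 < l) (s : ℕ) :
    ∫ ω, blockRem (fun i => b i ω) (l ^ 6) s ∂μ ≤ 10 ^ 7 * (u ^ 7 * l ^ 8) := by
  have hl' : (0 : ℝ) < l := by exact_mod_cast hl
  have hg : u ^ 2 * cbrtDist 0 (l ^ 6) = (u * l) ^ 2 := by
    rw [cbrtDist_zero_pow_six]
    ring
  simp only [blockRem]
  rw [integral_finsetSum _ fun r _ => (((hV.hasMoments (midDev_mem hmem s r)).pow 2).mul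
    ((hV.hasMoments (incr_mem hmem (s + r))).abs.pow 5)).integrable]
  refine (Finset.sum_le_sum fun r hr => hV.integral_sq_mul_abs_pow_five_le (midDev_mem hmem s r)
    (incr_mem hmem (s + r)) (x := u * l) (by positivity) hu
    (hg ▸ hb.integral_midDev_mul_self_le hV hmem (Finset.mem_range.1 hr))
    (hb.integral_incr_mul_self _).le).trans_eq ?_
  simp only [Finset.sum_const, Finset.card_range, nsmul_eq_mul]
  push_cast
  ring

theorem hasMoments_expansionError (hV : IsGaussianSpace V μ) (hmem : ∀ i, b i ∈ V) (L N : ℕ)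
    (τ : ℝ) : HasMoments (fun ω => expansionError (fun i => b i ω) L N τ) μ := by
  have hY := fun i => hV.hasMoments (incr_mem hmem i)
  exact (HasMoments.sum _ fun i _ => (hY i).abs.pow 7).add
    ((HasMoments.sum _ fun q _ => ((hasMoments_blockSum hV hmem L (q * L)).abs.add
      (hasMoments_blockDev hV hmem L (q * L)).abs).add (hasMoments_blockRem hV hmem L (q * L))).add
      ((HasMoments.const _).add ((HasMoments.sum _ fun i _ => (hY i).pow 10).const_mul _)))

theorem integral_expansionError_le (hb : HasCbrtCov b u μ) (hV : IsGaussianSpace V μ)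
    (hmem : ∀ i, b i ∈ V) {w T : ℝ} (hw : 0 < w) (hw1 : w ≤ 1) (hu : u = w ^ 5) {l N : ℕ}
    (hl : 1 ≤ l * w ^ 2) (hl2 : l * w ^ 2 ≤ 2) (hN : N * u ^ 6 ≤ T) :
    ∫ ω, expansionError (fun i => b i ω) (l ^ 6) N (u ^ 3) ∂μ ≤ 10 ^ 19 * (T + 1) * w := by
  have hu0 : 0 < u := hu ▸ by positivity
  have hlpos : 0 < l := by
    rcases Nat.eq_zero_or_pos l with rfl | h
    · norm_num at hl
    · exact h
  have hT : 0 ≤ T := le_trans (by positivity) hN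
  have hY := fun i => hV.hasMoments (incr_mem hmem i)
  have mS := fun q => (hasMoments_blockSum hV hmem (l ^ 6) (q * l ^ 6)).abs
  have mD := fun q => (hasMoments_blockDev hV hmem (l ^ 6) (q * l ^ 6)).abs
  have mR := fun q => hasMoments_blockRem hV hmem (l ^ 6) (q * l ^ 6)
  simp only [expansionError]
  have m7 := HasMoments.sum (Finset.range N) fun i _ => (hY i).abs.pow 7
  have mB := HasMoments.sum (Finset.range (N / l ^ 6)) fun q _ => ((mS q).add (mD q)).add (mR q)
  have m10 := (HasMoments.sum (Finset.range N) fun i _ => (hY i).pow 10).const_mul (u ^ 3)⁻¹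
  have mτ := HasMoments.const (μ := μ) (((l ^ 6 : ℕ) : ℝ) * u ^ 3)
  rw [integral_add m7.integrable (mB.add (mτ.add m10)).integrable,
    integral_add mB.integrable (mτ.add m10).integrable,
    integral_add mτ.integrable m10.integrable, integral_const, integral_const_mul,
    integral_finsetSum _ fun i _ => ((hY i).abs.pow 7).integrable,
    integral_finsetSum _ fun i _ => ((hY i).pow 10).integrable,
    integral_finsetSum _ fun q _ => (((mS q).add (mD q)).add (mR q)).integrable]
  have h7 : ∑ i ∈ Finset.range N, ∫ ω, |incr (fun i => b i ω) i| ^ 7 ∂μ ≤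
      N * (10 ^ 5 * u ^ 7) := by
    refine (Finset.sum_le_sum fun i _ => hV.integral_abs_pow_seven_le (incr_mem hmem i) hu0
      (hb.integral_incr_mul_self i).le).trans_eq ?_
    simp
  have h10 : ∑ i ∈ Finset.range N, ∫ ω, incr (fun i => b i ω) i ^ 10 ∂μ ≤
      N * (10 ^ 7 * u ^ 10) := by
    have h : ∀ i ∈ Finset.range N, ∫ ω, incr (fun i => b i ω) i ^ 10 ∂μ ≤ 10 ^ 7 * u ^ 10 := by
      intro i _
      refine (hV.integral_even_pow_le (incr_mem hmem i) (hb.integral_incr_mul_self i).le 5).trans ?_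
      have : 0 < u ^ 10 := by positivity
      norm_num [Nat.factorial]
      linarith
    refine (Finset.sum_le_sum h).trans_eq ?_
    simp
  have hB : ∑ q ∈ Finset.range (N / l ^ 6), ∫ ω, (|blockSum (fun i => b i ω) (l ^ 6) (q * l ^ 6)|
      + |blockDev (fun i => b i ω) (l ^ 6) (q * l ^ 6)|
      + blockRem (fun i => b i ω) (l ^ 6) (q * l ^ 6)) ∂μ ≤
      (N / l ^ 6 : ℕ) * (10 ^ 7 * (u ^ 5 * l ^ 3) + 10 ^ 18 * (u ^ 6 * l ^ 5)
        + 10 ^ 7 * (u ^ 7 * l ^ 8)) := by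
    have h : ∀ q ∈ Finset.range (N / l ^ 6),
        ∫ ω, (|blockSum (fun i => b i ω) (l ^ 6) (q * l ^ 6)|
          + |blockDev (fun i => b i ω) (l ^ 6) (q * l ^ 6)|
          + blockRem (fun i => b i ω) (l ^ 6) (q * l ^ 6)) ∂μ ≤
        10 ^ 7 * (u ^ 5 * l ^ 3) + 10 ^ 18 * (u ^ 6 * l ^ 5) + 10 ^ 7 * (u ^ 7 * l ^ 8) := by
      intro q _
      rw [integral_add ((mS q).add (mD q)).integrable (mR q).integrable,
        integral_add (mS q).integrable (mD q).integrable]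
      exact add_le_add (add_le_add (hb.integral_abs_blockSum_le hV hmem hu0 hlpos _)
        (hb.integral_abs_blockDev_le hV hmem hu0 hlpos _))
        (hb.integral_blockRem_le hV hmem hu0 hlpos _)
    refine (Finset.sum_le_sum h).trans_eq ?_
    rw [Finset.sum_const, Finset.card_range, nsmul_eq_mul]
  set Q : ℝ := ((N / l ^ 6 : ℕ) : ℝ) with hQ
  have hQN : Q * l ^ 6 * u ^ 6 ≤ T := by
    refine le_trans (mul_le_mul_of_nonneg_right ?_ (by positivity)) hN
    rw [hQ]
    exact_mod_cast Nat.div_mul_le_self N (l ^ 6)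
  have hQ0 : 0 ≤ Q := Nat.cast_nonneg _
  have huw : u ≤ w := hu ▸ pow_le_of_le_one hw.le hw1 (by norm_num)
  have t7 : N * u ^ 7 ≤ T * w := by
    calc N * u ^ 7 = N * u ^ 6 * u := by ring
      _ ≤ T * w := by gcongr
  have tS : Q * (u ^ 5 * l ^ 3) ≤ T * w := by
    calc Q * (u ^ 5 * l ^ 3) ≤ Q * (u ^ 5 * l ^ 3) * (l * w ^ 2) ^ 3 :=
          le_mul_of_one_le_right (by positivity) (one_le_pow₀ hl)
      _ = Q * l ^ 6 * u ^ 6 * w := by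
          rw [hu]
          ring
      _ ≤ T * w := by gcongr
  have tD : Q * (u ^ 6 * l ^ 5) ≤ T * w := by
    calc Q * (u ^ 6 * l ^ 5) ≤ Q * (u ^ 6 * l ^ 5) * (l * w ^ 2) :=
          le_mul_of_one_le_right (by positivity) hl
      _ = Q * l ^ 6 * u ^ 6 * (w * w) := by ring
      _ ≤ T * (1 * w) := by gcongr
      _ = T * w := by ring
  have tR : Q * (u ^ 7 * l ^ 8) ≤ T * (4 * w) := by
    calc Q * (u ^ 7 * l ^ 8) = Q * l ^ 6 * u ^ 6 * ((l * w ^ 2) ^ 2 * w) := by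
          rw [hu]
          ring
      _ ≤ T * (2 ^ 2 * w) := by gcongr
      _ = _ := by ring
  have tτ : (l : ℝ) ^ 6 * u ^ 3 ≤ 64 * w := by
    calc (l : ℝ) ^ 6 * u ^ 3 = (l * w ^ 2) ^ 6 * (w ^ 2 * w) := by
          rw [hu]
          ring
      _ ≤ 2 ^ 6 * (1 ^ 2 * w) := by gcongr
      _ = _ := by ring
  have t10 : (u ^ 3)⁻¹ * (N * (10 ^ 7 * u ^ 10)) = 10 ^ 7 * (N * u ^ 7) := by
    field_simp
  have h10' := mul_le_mul_of_nonneg_left h10 (show 0 ≤ (u ^ 3)⁻¹ by positivity)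
  rw [t10] at h10'
  have hTw : 0 ≤ T * w := by positivity
  simp only [probReal_univ, smul_eq_mul, one_mul]
  push_cast
  nlinarith

end HasCbrtCov

namespace IsFBM16

variable {Ω : Type*} [MeasureSpace Ω] {B : ℝ → Ω → ℝ}

theorem isGaussianSpace (hB : IsFBM16 B) :
    IsGaussianSpace (Submodule.span ℝ (B '' Set.Ici 0)) (volume : Measure Ω) := by
  intro X hX
  obtain ⟨m, c, g, rfl⟩ := Submodule.mem_span_set'.1 hX
  choose t ht0 ht using fun i => (g i).2
  have e : (∑ i, c i • (g i : Ω → ℝ)) = fun ω => ∑ i, c i * B (t i) ω := by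
    ext ω
    simp [Finset.sum_apply, ht]
  rw [e]
  exact ⟨Finset.measurable_sum _ fun i _ => (hB.1 (t i)).const_mul _, hB.2.2.1 m t c ht0⟩

theorem integral_sub_mul_sub [IsProbabilityMeasure (volume : Measure Ω)] (hB : IsFBM16 B)
    {p q r s : ℝ} (hp : 0 ≤ p) (hq : 0 ≤ q) (hr : 0 ≤ r) (hs : 0 ≤ s) :
    ∫ ω, (B p ω - B q ω) * (B r ω - B s ω) =
      (|p - s| ^ ((1 : ℝ) / 3) + |q - r| ^ ((1 : ℝ) / 3) - |p - r| ^ ((1 : ℝ) / 3)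
        - |q - s| ^ ((1 : ℝ) / 3)) / 2 := by
  have hm : ∀ t, 0 ≤ t → HasMoments (B t) volume := fun t ht =>
    hB.isGaussianSpace.hasMoments (Submodule.subset_span ⟨t, ht, rfl⟩)
  have e : ∀ ω, (B p ω - B q ω) * (B r ω - B s ω)
      = B p ω * B r ω - B p ω * B s ω - (B q ω * B r ω - B q ω * B s ω) := fun ω => by ring
  simp_rw [e]
  have pr := (hm p hp).mul (hm r hr)
  have ps := (hm p hp).mul (hm s hs)
  have qr := (hm q hq).mul (hm r hr)
  have qs := (hm q hq).mul (hm s hs)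
  rw [integral_sub (pr.sub ps).integrable (qr.sub qs).integrable,
    integral_sub pr.integrable ps.integrable, integral_sub qr.integrable qs.integrable,
    hB.2.2.2 p r hp hr, hB.2.2.2 p s hp hs, hB.2.2.2 q r hq hr, hB.2.2.2 q s hq hs,
    abs_sub_comm r p, abs_sub_comm s p, abs_sub_comm r q, abs_sub_comm s q]
  ring

theorem hasCbrtCov [IsProbabilityMeasure (volume : Measure Ω)] (hB : IsFBM16 B) {n : ℕ} {u : ℝ}
    (hu : u ^ 2 = ((n : ℝ)⁻¹) ^ ((1 : ℝ) / 3)) :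
    HasCbrtCov (fun i => B ((i : ℝ) / n)) u volume := by
  intro i j k l
  have hscale : ∀ a c : ℕ, |(a : ℝ) / n - (c : ℝ) / n| ^ ((1 : ℝ) / 3) = u ^ 2 * cbrtDist a c := by
    intro a c
    rw [← sub_div, abs_div, Nat.abs_cast, div_eq_inv_mul, Real.mul_rpow (by positivity)
      (abs_nonneg _), hu, cbrtDist]
  rw [hB.integral_sub_mul_sub (by positivity) (by positivity) (by positivity) (by positivity),
    hscale, hscale, hscale, hscale]
  ring

/-- The expected expansion error along the grid of mesh `1 / n` decays like `n ^ (-1/30)`. -/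
theorem exists_integral_expansionError_le [IsProbabilityMeasure (volume : Measure Ω)]
    (hB : IsFBM16 B) {T : ℝ} (hT : 0 ≤ T) {n : ℕ} (hn : 0 < n) :
    ∃ L > 0, ∃ τ > 0,
      Integrable (fun ω => expansionError (fun i => B ((i : ℝ) / n) ω) L ⌊(n : ℝ) * T⌋₊ τ) ∧
      ∫ ω, expansionError (fun i => B ((i : ℝ) / n) ω) L ⌊(n : ℝ) * T⌋₊ τ ≤
        10 ^ 19 * (T + 1) * (n : ℝ) ^ (-(1 / 30) : ℝ) := by
  have hn1 : (1 : ℝ) ≤ n := by exact_mod_cast hn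
  have hn0 : (0 : ℝ) < n := by linarith
  set w : ℝ := (n : ℝ) ^ (-(1 / 30) : ℝ) with hw
  have hw0 : 0 < w := by positivity
  have hw1 : w ≤ 1 := Real.rpow_le_one_of_one_le_of_nonpos hn1 (by norm_num)
  have hu2 : (w ^ 5) ^ 2 = ((n : ℝ)⁻¹) ^ ((1 : ℝ) / 3) := by
    rw [← pow_mul, hw, ← Real.rpow_natCast, ← Real.rpow_mul hn0.le, Real.inv_rpow hn0.le,
      ← Real.rpow_neg hn0.le]
    norm_num
  have hu6 : (w ^ 5) ^ 6 = (n : ℝ)⁻¹ := by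
    rw [← pow_mul, hw, ← Real.rpow_natCast, ← Real.rpow_mul hn0.le, ← Real.rpow_neg_one]
    norm_num
  have hmem : ∀ i : ℕ, B ((i : ℝ) / n) ∈ Submodule.span ℝ (B '' Set.Ici 0) := fun i =>
    Submodule.subset_span ⟨_, Set.mem_Ici.2 (by positivity), rfl⟩
  set l := ⌈(w ^ 2)⁻¹⌉₊ with hl
  have hl0 : 0 < l := Nat.ceil_pos.2 (by positivity)
  have hl1 : 1 ≤ l * w ^ 2 := by
    have := mul_le_mul_of_nonneg_right (Nat.le_ceil (w ^ 2)⁻¹) (sq_nonneg w)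
    rwa [inv_mul_cancel₀ (by positivity)] at this
  have hl2 : l * w ^ 2 ≤ 2 := by
    have h := mul_le_mul_of_nonneg_right (Nat.ceil_lt_add_one (a := (w ^ 2)⁻¹)
      (by positivity)).le (sq_nonneg w)
    rw [add_mul, inv_mul_cancel₀ (by positivity), one_mul] at h
    have := pow_le_one₀ (n := 2) hw0.le hw1
    linarith
  have hN : (⌊(n : ℝ) * T⌋₊ : ℝ) * (w ^ 5) ^ 6 ≤ T := by
    rw [hu6]
    have := mul_le_mul_of_nonneg_right (Nat.floor_le (show 0 ≤ (n : ℝ) * T by positivity))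
      (inv_nonneg.2 hn0.le)
    refine this.trans_eq ?_
    field_simp
  exact ⟨l ^ 6, by positivity, (w ^ 5) ^ 3, by positivity,
    (HasCbrtCov.hasMoments_expansionError hB.isGaussianSpace hmem _ _ _).integrable,
    (hB.hasCbrtCov hu2).integral_expansionError_le hB.isGaussianSpace hmem hw0 hw1 rfl hl1 hl2 hN⟩

theorem exists_measure_exceed_le [IsProbabilityMeasure (volume : Measure Ω)] (hB : IsFBM16 B)
    (T : ℝ) {δ : ENNReal} (hδ : 0 < δ) :
    ∃ R : ℕ, volume {ω | ∃ q : ℚ, (q : ℝ) ∈ Set.Icc 0 T ∧ (R : ℝ) < |B q ω|} ≤ δ := by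
  set A : ℕ → Set Ω := fun R => {ω | ∃ q : ℚ, (q : ℝ) ∈ Set.Icc 0 T ∧ (R : ℝ) < |B q ω|} with hA
  have hmeas : ∀ R, MeasurableSet (A R) := fun R => by
    have e : A R = ⋃ q : ℚ, {ω | (q : ℝ) ∈ Set.Icc 0 T ∧ (R : ℝ) < |B q ω|} := by
      ext ω
      simp [hA]
    rw [e]
    exact MeasurableSet.iUnion fun q => (MeasurableSet.const _).inter
      (measurableSet_lt measurable_const (hB.1 q).abs)
  have hanti : Antitone A := fun R S hRS ω ⟨q, hq, h⟩ =>
    ⟨q, hq, lt_of_le_of_lt (by exact_mod_cast hRS) h⟩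
  have hempty : ⋂ R, A R = ∅ := by
    refine Set.eq_empty_of_forall_notMem fun ω hω => ?_
    obtain ⟨C, hC⟩ := isCompact_Icc.exists_bound_of_continuousOn
      (s := Set.Icc 0 T) (hB.2.1 ω).continuousOn
    obtain ⟨R, hR⟩ := exists_nat_ge C
    obtain ⟨q, hq, h⟩ := Set.mem_iInter.1 hω R
    have := hC q hq
    rw [Real.norm_eq_abs] at this
    linarith
  have ht := tendsto_measure_iInter_atTop (μ := (volume : Measure Ω))
    (fun R => (hmeas R).nullMeasurableSet) hanti ⟨0, measure_ne_top _ _⟩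
  rw [hempty, measure_empty] at ht
  exact ((ENNReal.tendsto_nhds_zero.1 ht δ hδ).exists)

end IsFBM16

theorem sum_Icc_one_eq_sum_range {M : Type*} [AddCommMonoid M] (F : ℕ → M) (K : ℕ) :
    ∑ j ∈ Finset.Icc 1 K, F j = ∑ i ∈ Finset.range K, F (i + 1) := by
  induction K with
  | zero => simp
  | succ K ih => rw [Finset.sum_Icc_succ_top (by omega), Finset.sum_range_succ, ih]

theorem exists_abs_iteratedDeriv_le {f : ℝ → ℝ} (hf : ContDiff ℝ (⊤ : ℕ∞) f) (m : ℕ) (R : ℝ) :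
    ∃ C, ∀ y, |y| ≤ R → |iteratedDeriv m f y| ≤ C := by
  obtain ⟨C, hC⟩ := isCompact_Icc.exists_bound_of_continuousOn (s := Set.Icc (-R) R)
    (hf.continuous_iteratedDeriv m (by exact_mod_cast le_top)).continuousOn
  exact ⟨C, fun y hy => hC y (abs_le.1 hy)⟩

/-- For smooth `f`, uniformly on `[0,T]` in probability,
`f(B(⌊nt⌋/n)) - f(B(0)) ≈ ∑_{j=1}^{⌊nt⌋} ( f'(β_{j,n}) ΔB_{j,n} + (1/24) f'''(β_{j,n}) ΔB_{j,n}³ )`. -/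
theorem stmt8 {Ω : Type*} [MeasureSpace Ω] [IsProbabilityMeasure (volume : Measure Ω)]
    (B : ℝ → Ω → ℝ) (hB : IsFBM16 B) (f : ℝ → ℝ) (hf : ContDiff ℝ (⊤ : ℕ∞) f) :
    ∀ T > (0 : ℝ), ∀ ε > (0 : ℝ),
      Tendsto (fun n : ℕ =>
          volume {ω : Ω | ε ≤
            ⨆ t ∈ Set.Icc (0 : ℝ) T,
              |f (B ((⌊(n : ℝ) * t⌋₊ : ℝ) / n) ω) - f (B 0 ω)
                - ∑ j ∈ Finset.Icc 1 ⌊(n : ℝ) * t⌋₊,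
                    (deriv f ((B (((j : ℝ) - 1) / n) ω + B ((j : ℝ) / n) ω) / 2) *
                        (B ((j : ℝ) / n) ω - B (((j : ℝ) - 1) / n) ω)
                      + (1 / 24) *
                          iteratedDeriv 3 f
                            ((B (((j : ℝ) - 1) / n) ω + B ((j : ℝ) / n) ω) / 2) *
                          (B ((j : ℝ) / n) ω - B (((j : ℝ) - 1) / n) ω) ^ 3)|})
        atTop (𝓝 0) := by
  intro T hT ε hε
  refine ENNReal.tendsto_nhds_zero.2 fun δ hδ => ?_
  obtain ⟨R, hR⟩ := hB.exists_measure_exceed_le T (ENNReal.half_pos hδ.ne')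
  obtain ⟨C5, hC5⟩ := exists_abs_iteratedDeriv_le hf 5 R
  obtain ⟨C6, hC6⟩ := exists_abs_iteratedDeriv_le hf 6 R
  obtain ⟨C7, hC7⟩ := exists_abs_iteratedDeriv_le hf 7 R
  obtain ⟨C, hC0, h5, h6, h7⟩ : ∃ C, 0 ≤ C ∧ C5 ≤ C ∧ C6 ≤ C ∧ C7 ≤ C :=
    ⟨max 0 (max C5 (max C6 C7)), by simp, by simp, by simp, by simp⟩
  have hlim : Tendsto (fun n : ℕ => ENNReal.ofReal
      (C * (10 ^ 19 * (T + 1) * (n : ℝ) ^ (-(1 / 30) : ℝ)) / ε)) atTop (𝓝 0) := by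
    have h := (tendsto_rpow_neg_atTop (y := 1 / 30) (by norm_num)).comp
      (tendsto_natCast_atTop_atTop (R := ℝ))
    have h' := ((h.const_mul (10 ^ 19 * (T + 1))).const_mul C).div_const ε
    simpa using ENNReal.tendsto_ofReal h'
  filter_upwards [ENNReal.tendsto_nhds_zero.1 hlim _ (ENNReal.half_pos hδ.ne'),
    eventually_gt_atTop 0] with n hnlim hn
  have hn0 : (0 : ℝ) < n := by exact_mod_cast hn
  obtain ⟨L, hL, τ, hτ, hint, hexp⟩ := hB.exists_integral_expansionError_le hT.le hn
  set N := ⌊(n : ℝ) * T⌋₊ with hN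
  set Z : Ω → ℝ := fun ω => expansionError (fun i => B ((i : ℝ) / n) ω) L N τ with hZ
  have hZ0 : ∀ ω, 0 ≤ Z ω := fun ω => expansionError_nonneg _ _ _ hτ.le
  have hsub : {ω : Ω | ε ≤ ⨆ t ∈ Set.Icc (0 : ℝ) T,
      |f (B ((⌊(n : ℝ) * t⌋₊ : ℝ) / n) ω) - f (B 0 ω)
        - ∑ j ∈ Finset.Icc 1 ⌊(n : ℝ) * t⌋₊,
            (deriv f ((B (((j : ℝ) - 1) / n) ω + B ((j : ℝ) / n) ω) / 2) *
                (B ((j : ℝ) / n) ω - B (((j : ℝ) - 1) / n) ω)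
              + (1 / 24) *
                  iteratedDeriv 3 f
                    ((B (((j : ℝ) - 1) / n) ω + B ((j : ℝ) / n) ω) / 2) *
                  (B ((j : ℝ) / n) ω - B (((j : ℝ) - 1) / n) ω) ^ 3)|}
      ⊆ {ω | ∃ q : ℚ, (q : ℝ) ∈ Set.Icc 0 T ∧ (R : ℝ) < |B q ω|} ∪ {ω | ε ≤ C * Z ω} := by
    intro ω hω
    rw [Set.mem_ofPred_eq] at hω
    by_cases hexc : ∃ q : ℚ, (q : ℝ) ∈ Set.Icc 0 T ∧ (R : ℝ) < |B q ω|
    · exact Or.inl hexc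
    refine Or.inr (show ε ≤ C * Z ω from hω.trans ?_)
    have hCZ : 0 ≤ C * Z ω := mul_nonneg hC0 (hZ0 ω)
    have hgrid : ∀ i ≤ N, |B ((i : ℝ) / n) ω| ≤ R := by
      intro i hi
      by_contra! h
      refine hexc ⟨(i : ℚ) / n, ⟨by positivity, ?_⟩, by push_cast; exact h⟩
      push_cast
      rw [div_le_iff₀ hn0, mul_comm]
      exact (Nat.le_floor_iff (by positivity)).1 hi
    refine Real.iSup_le (fun t => Real.iSup_le (fun ht => ?_) hCZ) hCZ
    have h := abs_expansion_le hf (fun y hy => (hC5 y hy).trans h5)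
      (fun y hy => (hC6 y hy).trans h6) (fun y hy => (hC7 y hy).trans h7) hτ hL
      (K := ⌊(n : ℝ) * t⌋₊) (N := N)
      (Nat.floor_mono (mul_le_mul_of_nonneg_left ht.2 hn0.le)) hgrid
    refine le_trans (le_of_eq ?_) h
    rw [sum_Icc_one_eq_sum_range]
    simp [incr]
  calc _ ≤ volume {ω | ∃ q : ℚ, (q : ℝ) ∈ Set.Icc 0 T ∧ (R : ℝ) < |B q ω|}
        + volume {ω | ε ≤ C * Z ω} := (measure_mono hsub).trans (measure_union_le _ _)
    _ ≤ δ / 2 + δ / 2 := by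
        refine add_le_add hR (le_trans ?_ hnlim)
        have hM := mul_meas_ge_le_integral_of_nonneg (μ := (volume : Measure Ω))
          (ae_of_all _ fun ω => mul_nonneg hC0 (hZ0 ω)) (hint.const_mul C) ε
        rw [integral_const_mul] at hM
        rw [← ofReal_measureReal]
        refine ENNReal.ofReal_le_ofReal ?_
        rw [le_div_iff₀ hε, mul_comm]
        exact hM.trans (mul_le_mul_of_nonneg_left hexp hC0)
    _ = δ := ENNReal.add_halves δ
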